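/- For every α ∈ (0, 1/2] and all constants c₀, c₁ > 0 there exist constants C₁, C₂ > 0, depending only on α, c₀, c₁, such that for all integers S ≥ 2 and n ≥ 2 with n·ln S ≥ c₀·S^{1/α} and ln n ≤ c₁·ln S, the minimax risk for estimating F_α(P) over P ∈ M_S under the Poissonized sampling model with parameter n satisfies C₁·S²/(n·ln n)^{2α} ≤ inf_{F̂} sup_{P ∈ M_S} E_P[(F̂(Z) − F_α(P))²] ≤ C₂·S²/(n·ln n)^{2α}. -/

import Mathlib

open scoped BigOperators ENNReal

/-- The probability simplex on `S` outcomes. -/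
def simplex (S : ℕ) : Set (Fin S → ℝ) :=
  {P | (∀ i, 0 ≤ P i) ∧ ∑ i, P i = 1}

/-- Joint pmf of independent Poisson observations `Z i ~ Poisson (lam * P i)`. -/
noncomputable def poissonPMF (S : ℕ) (lam : ℝ) (P : Fin S → ℝ) (z : Fin S → ℕ) : ℝ :=
  ∏ i, Real.exp (-(lam * P i)) * (lam * P i) ^ (z i) / (Nat.factorial (z i) : ℝ)

/-- Expected squared error of an estimator under the Poissonized model. -/
noncomputable def poissonRisk (S : ℕ) (lam : ℝ) (P : Fin S → ℝ) (t : ℝ)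
    (est : (Fin S → ℕ) → ℝ) : ℝ≥0∞ :=
  ∑' z : Fin S → ℕ, ENNReal.ofReal (poissonPMF S lam P z * (est z - t) ^ 2)

/-- Minimax risk for estimating `F P` under the Poissonized model. -/
noncomputable def poissonMinimax (S : ℕ) (lam : ℝ) (F : (Fin S → ℝ) → ℝ) : ℝ≥0∞ :=
  ⨅ est : (Fin S → ℕ) → ℝ, ⨆ P ∈ simplex S, poissonRisk S lam P (F P) est

/-- The power-sum functional `F_α(P) = ∑ i, (P i)^α` (real power; `0^α = 0` for `α > 0`). -/
noncomputable def Falpha (S : ℕ) (α : ℝ) (P : Fin S → ℝ) : ℝ :=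
  ∑ i, P i ^ α

section

open MeasureTheory
open ProbabilityTheory hiding poissonPMF
open scoped ENNReal NNReal

/-- Second moment of a sum of independent coordinates. -/
lemma integral_sq_sum_pi {ι : Type*} [Fintype ι] {Ω : ι → Type*} {mΩ : ∀ i, MeasurableSpace (Ω i)}
    {μ : (i : ι) → Measure (Ω i)} [∀ i, IsProbabilityMeasure (μ i)]
    {X : Π i, Ω i → ℝ} (h : ∀ i, MemLp (X i) 2 (μ i)) :
    ∫ ω, (∑ i, X i (ω i)) ^ 2 ∂(Measure.pi μ) =
      ∑ i, Var[X i; μ i] + (∑ i, ∫ ω, X i ω ∂(μ i)) ^ 2 := by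
  have hm : ∀ i, MemLp (fun ω : Π i, Ω i => X i (ω i)) 2 (Measure.pi μ) := fun i =>
    (h i).comp_measurePreserving (measurePreserving_eval _ i)
  have hs : MemLp (fun ω : Π i, Ω i => ∑ i, X i (ω i)) 2 (Measure.pi μ) :=
    memLp_finsetSum _ fun i _ => hm i
  have hv := variance_sum_pi h
  have he : (∑ i, fun ω : Π i, Ω i => X i (ω i)) = fun ω => ∑ i, X i (ω i) := by
    ext ω; simp
  rw [he, variance_eq_sub hs] at hv
  have hi : ∫ ω, ∑ i, X i (ω i) ∂(Measure.pi μ) = ∑ i, ∫ ω, X i ω ∂(μ i) := by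
    rw [integral_finsetSum _ fun i _ => (hm i).integrable (by norm_num)]
    exact Finset.sum_congr rfl fun i _ => integral_comp_eval (h i).1
  rw [hi] at hv
  have : (∫ ω, (∑ i, X i (ω i)) ^ 2 ∂(Measure.pi μ))
      = ∫ ω, ((fun ω : Π i, Ω i => ∑ i, X i (ω i)) ^ 2) ω ∂(Measure.pi μ) := rfl
  rw [this]
  linarith

lemma poissonPMF_nonneg {S : ℕ} {lam : ℝ} {P : Fin S → ℝ} (h : ∀ i, 0 ≤ lam * P i)
    (z : Fin S → ℕ) : 0 ≤ poissonPMF S lam P z :=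
  Finset.prod_nonneg fun i _ => by have := h i; positivity

lemma ofReal_poissonPMF {S : ℕ} {lam : ℝ} {P : Fin S → ℝ} (h : ∀ i, 0 ≤ lam * P i)
    (z : Fin S → ℕ) : ENNReal.ofReal (poissonPMF S lam P z) =
      Measure.pi (fun i => poissonMeasure (lam * P i).toNNReal) {z} := by
  rw [Measure.pi_singleton, poissonPMF, ENNReal.ofReal_prod_of_nonneg]
  · exact Finset.prod_congr rfl fun i _ => by
      rw [poissonMeasure_singleton, Real.coe_toNNReal _ (h i)]
  · intro i _
    have := h i
    positivity

lemma hasSum_poissonPMF {S : ℕ} {lam : ℝ} {P : Fin S → ℝ} (h : ∀ i, 0 ≤ lam * P i) :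
    HasSum (poissonPMF S lam P) 1 := by
  have hE : ∑' z, ENNReal.ofReal (poissonPMF S lam P z) = 1 := by
    have := lintegral_countable' (μ := Measure.pi (fun i => poissonMeasure (lam * P i).toNNReal))
      (fun _ => (1 : ℝ≥0∞))
    simp only [lintegral_const, measure_univ, one_mul] at this
    rw [this]
    exact tsum_congr fun z => ofReal_poissonPMF h z
  have hs : Summable (poissonPMF S lam P) := by
    have := ENNReal.summable_toReal (f := fun z => ENNReal.ofReal (poissonPMF S lam P z))
      (by rw [hE]; simp)
    simpa [ENNReal.toReal_ofReal (poissonPMF_nonneg h _)] using this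
  have := ENNReal.ofReal_tsum_of_nonneg (fun z => poissonPMF_nonneg h z) hs
  rw [hE] at this
  have h1 : ∑' z, poissonPMF S lam P z = 1 := by
    simpa using this
  rw [← h1]
  exact hs.hasSum

lemma poissonRisk_eq_lintegral {S : ℕ} {lam : ℝ} {P : Fin S → ℝ} (h : ∀ i, 0 ≤ lam * P i)
    (t : ℝ) (est : (Fin S → ℕ) → ℝ) : poissonRisk S lam P t est =
      ∫⁻ z, ENNReal.ofReal ((est z - t) ^ 2)
        ∂(Measure.pi (fun i => poissonMeasure (lam * P i).toNNReal)) := by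
  rw [lintegral_countable', poissonRisk]
  refine tsum_congr fun z => ?_
  rw [ENNReal.ofReal_mul (poissonPMF_nonneg h z), ofReal_poissonPMF h, mul_comm]

/-- Risk of an additive estimator in terms of the bias and second moment of each summand. -/
lemma poissonRisk_sum_le {S : ℕ} {lam : ℝ} {P : Fin S → ℝ} (h : ∀ i, 0 ≤ lam * P i)
    (f : Fin S → ℝ) (g : ℕ → ℝ) (B V : ℝ)
    (hg : ∀ i, MemLp g 2 (poissonMeasure (lam * P i).toNNReal))
    (hB : ∀ i, |∫ z, g z ∂(poissonMeasure (lam * P i).toNNReal) - f i| ≤ B)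
    (hV : ∀ i, ∫ z, (g z - f i) ^ 2 ∂(poissonMeasure (lam * P i).toNNReal) ≤ V) :
    poissonRisk S lam P (∑ i, f i) (fun z => ∑ i, g (z i)) ≤
      ENNReal.ofReal (S * V + (S * B) ^ 2) := by
  have hX : ∀ i, MemLp (fun z => g z - f i) 2 (poissonMeasure (lam * P i).toNNReal) := fun i =>
    (hg i).sub (memLp_const _)
  have hm : MemLp (fun z : Fin S → ℕ => ∑ i, (g (z i) - f i)) 2
      (Measure.pi (fun i => poissonMeasure (lam * P i).toNNReal)) :=
    memLp_finsetSum _ fun i _ => (hX i).comp_measurePreserving (measurePreserving_eval _ i)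
  rw [poissonRisk_eq_lintegral h]
  simp_rw [← Finset.sum_sub_distrib]
  rw [← ofReal_integral_eq_lintegral_ofReal hm.integrable_sq (.of_forall fun _ => sq_nonneg _),
    integral_sq_sum_pi hX]
  apply ENNReal.ofReal_le_ofReal
  refine add_le_add ?_ ?_
  · calc _ ≤ ∑ i : Fin S, V := Finset.sum_le_sum fun i _ =>
          (variance_le_expectation_sq (hX i).1).trans (hV i)
      _ = S * V := by simp
  · have habs : |∑ i, ∫ z, (g z - f i) ∂(poissonMeasure (lam * P i).toNNReal)| ≤ S * B := by
      calc _ ≤ ∑ i : Fin S, |∫ z, (g z - f i) ∂(poissonMeasure (lam * P i).toNNReal)| :=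
            Finset.abs_sum_le_sum_abs _ _
        _ ≤ ∑ i : Fin S, B := Finset.sum_le_sum fun i _ => by
            rw [integral_sub ((hg i).integrable (by norm_num)) (integrable_const _)]
            simpa using hB i
        _ = S * B := by simp
    exact sq_le_sq' (neg_le_of_abs_le habs) (le_of_abs_le habs)

lemma gamma_nat_add_half_mul (z : ℕ) :
    Real.Gamma (z + 1 / 2) * (4 ^ z * z.factorial) = √Real.pi * (2 * z).factorial := by
  induction z with
  | zero => simpa using Real.Gamma_one_half_eq
  | succ z ih =>
    have h1 : ((z + 1 : ℕ) : ℝ) + 1 / 2 = ((z : ℝ) + 1 / 2) + 1 := by push_cast; ring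
    rw [h1, Real.Gamma_add_one (by positivity), show 2 * (z + 1) = 2 * z + 1 + 1 by ring,
      Nat.factorial_succ, Nat.factorial_succ, Nat.factorial_succ]
    push_cast
    linear_combination (4 * ((z : ℝ) + 1 / 2) * (z + 1)) * ih

/-- The density of `± √G` with a uniform sign and `G` a Gamma variable of shape `z + 1/2`. -/
noncomputable def rootGammaDensity (z : ℕ) (r : ℝ) : ℝ :=
  4 ^ z * z.factorial / (√Real.pi * (2 * z).factorial) * (r ^ (2 * z) * Real.exp (-r ^ 2))

lemma rootGammaDensity_nonneg (z : ℕ) (r : ℝ) : 0 ≤ rootGammaDensity z r := by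
  unfold rootGammaDensity
  have : 0 ≤ r ^ (2 * z) := (even_two_mul z).pow_nonneg r
  positivity

lemma integrable_rootGammaDensity (z : ℕ) : Integrable (rootGammaDensity z) := by
  have := integrable_rpow_mul_exp_neg_mul_sq (b := 1) one_pos (s := (2 * z : ℕ))
    (lt_of_lt_of_le (by norm_num) (Nat.cast_nonneg _))
  simp only [Real.rpow_natCast, neg_mul, one_mul] at this
  exact this.const_mul _

lemma integral_rootGammaDensity (z : ℕ) : ∫ r, rootGammaDensity z r = 1 := by
  have h := integral_rpow_mul_exp_neg_rpow (p := 2) (q := (2 * z : ℕ)) two_pos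
    (lt_of_lt_of_le (by norm_num) (Nat.cast_nonneg _))
  have habs := integral_comp_abs (f := fun r : ℝ => r ^ (2 * z) * Real.exp (-r ^ 2))
  have h2 : ∫ r in Set.Ioi (0 : ℝ), r ^ (2 * z) * Real.exp (-r ^ 2) =
      1 / 2 * Real.Gamma (z + 1 / 2) := by
    have h3 : (((2 * z : ℕ) : ℝ) + 1) / 2 = z + 1 / 2 := by push_cast; ring
    rw [h3] at h
    rw [← h]
    refine setIntegral_congr_fun measurableSet_Ioi fun x hx => ?_
    simp only [Real.rpow_natCast, Real.rpow_ofNat]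
  rw [h2] at habs
  simp only [(even_two_mul z).pow_abs, sq_abs] at habs
  unfold rootGammaDensity
  rw [integral_const_mul, habs]
  have hg := gamma_nat_add_half_mul z
  have : √Real.pi * (2 * z).factorial ≠ 0 := by positivity
  field_simp at hg ⊢
  linarith

lemma hasSum_poisson_mul_rootGammaDensity (u r : ℝ) :
    HasSum (fun z : ℕ => Real.exp (-u ^ 2) * (u ^ 2) ^ z / z.factorial * rootGammaDensity z r)
      (Real.exp (-u ^ 2 - r ^ 2) / √Real.pi * Real.cosh (2 * u * r)) := by
  refine ((Real.hasSum_cosh (2 * u * r)).mul_left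
    (Real.exp (-u ^ 2 - r ^ 2) / √Real.pi)).congr_fun ?_
  intro z
  have h4 : (2 * u * r) ^ (2 * z) = 4 ^ z * (u ^ 2) ^ z * r ^ (2 * z) := by
    rw [mul_pow, mul_pow, pow_mul 2, pow_mul u]; norm_num
  rw [rootGammaDensity, h4, sub_eq_add_neg, Real.exp_add]
  have := Nat.factorial_ne_zero z
  field_simp

lemma gaussianPDFReal_half (u r : ℝ) :
    gaussianPDFReal u (1 / 2) r = (√Real.pi)⁻¹ * Real.exp (-(r - u) ^ 2) := by
  have h2 : 2 * Real.pi * ((1 / 2 : ℝ≥0) : ℝ) = Real.pi := by push_cast; ring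
  have h1 : 2 * ((1 / 2 : ℝ≥0) : ℝ) = 1 := by push_cast; ring
  simp only [gaussianPDFReal_def, h2, h1, div_one]

/-- Averaging over `Poisson (u ^ 2)` turns the root-Gamma family into a Gaussian. -/
lemma hasSum_integral_mul_rootGammaDensity {ψ : ℝ → ℝ} (hc : Continuous ψ) {K : ℝ}
    (hK : ∀ r, |ψ r| ≤ K) (he : ∀ r, ψ (-r) = ψ r) (u : ℝ) :
    HasSum (fun z : ℕ => Real.exp (-u ^ 2) * (u ^ 2) ^ z / z.factorial *
      ∫ r, ψ r * rootGammaDensity z r) (∫ r, ψ r ∂(gaussianReal u (1 / 2))) := by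
  have h_int : ∀ z, Integrable (fun r => ψ r * rootGammaDensity z r) := fun z =>
    (integrable_rootGammaDensity z).bdd_mul hc.aestronglyMeasurable (.of_forall hK)
  set p : ℕ → ℝ := fun z => Real.exp (-u ^ 2) * (u ^ 2) ^ z / z.factorial with hp
  have hp0 : ∀ z, 0 ≤ p z := fun z => by simp only [hp]; positivity
  have hps : Summable p := by
    have := (hasSum_one_poissonMeasure (Real.toNNReal (u ^ 2))).summable
    simpa only [Real.coe_toNNReal _ (sq_nonneg u)] using this
  have key := hasSum_integral_of_summable_integral_norm
    (F := fun z r => p z * (ψ r * rootGammaDensity z r)) (μ := volume)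
    (fun z => (h_int z).const_mul _) ?_
  · simp only [integral_const_mul] at key
    suffices hE : ∫ r, ψ r ∂(gaussianReal u (1 / 2)) =
        ∫ r, ∑' z, p z * (ψ r * rootGammaDensity z r) by
      rw [hE]; exact key
    have h1 : ∀ r, ∑' z, p z * (ψ r * rootGammaDensity z r) =
        (1 / 2) * (gaussianPDFReal u (1 / 2) r * ψ r) +
          (1 / 2) * (gaussianPDFReal u (1 / 2) (-r) * ψ (-r)) := by
      intro r
      have h2 := ((hasSum_poisson_mul_rootGammaDensity u r).mul_left (ψ r)).tsum_eq
      rw [tsum_congr (fun z => show p z * (ψ r * rootGammaDensity z r) =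
        ψ r * (p z * rootGammaDensity z r) by ring), h2, he, gaussianPDFReal_half,
        gaussianPDFReal_half, Real.cosh_eq]
      have e1 : Real.exp (-u ^ 2 - r ^ 2) * Real.exp (2 * u * r) = Real.exp (-(r - u) ^ 2) := by
        rw [← Real.exp_add]; ring_nf
      have e2 : Real.exp (-u ^ 2 - r ^ 2) * Real.exp (-(2 * u * r)) =
          Real.exp (-(-r - u) ^ 2) := by
        rw [← Real.exp_add]; ring_nf
      rw [← e1, ← e2]
      ring
    rw [integral_congr_ae (.of_forall h1)]
    have hi : Integrable (fun r => gaussianPDFReal u (1 / 2) r * ψ r) :=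
      (integrable_gaussianPDFReal _ _).mul_bdd hc.aestronglyMeasurable (.of_forall hK)
    rw [integral_add (hi.const_mul _) (hi.comp_neg.const_mul _), integral_const_mul,
      integral_const_mul, integral_neg_eq_self (fun r => gaussianPDFReal u (1 / 2) r * ψ r),
      integral_gaussianReal_eq_integral_smul (by simp)]
    simp only [smul_eq_mul]
    ring
  · refine Summable.of_nonneg_of_le (fun z => integral_nonneg fun r => norm_nonneg _)
      (fun z => ?_) (hps.mul_right K)
    calc ∫ r, ‖p z * (ψ r * rootGammaDensity z r)‖
        ≤ ∫ r, p z * K * rootGammaDensity z r := by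
          refine integral_mono ((h_int z).const_mul _).norm
            ((integrable_rootGammaDensity z).const_mul _) fun r => ?_
          have h1 := rootGammaDensity_nonneg z r
          simp only [norm_mul, Real.norm_eq_abs, abs_of_nonneg (hp0 z), abs_of_nonneg h1]
          rw [mul_assoc]
          have := hp0 z
          gcongr
          exact hK r
      _ = p z * K := by rw [integral_const_mul, integral_rootGammaDensity, mul_one]

lemma sq_integral_mul_rootGammaDensity_le {ψ : ℝ → ℝ} (hc : Continuous ψ) {K : ℝ}
    (hK : ∀ r, |ψ r| ≤ K) (z : ℕ) (t : ℝ) :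
    ((∫ r, ψ r * rootGammaDensity z r) - t) ^ 2 ≤ ∫ r, (ψ r - t) ^ 2 * rootGammaDensity z r := by
  have hI := integrable_rootGammaDensity z
  have h1 : Integrable (fun r => ψ r * rootGammaDensity z r) :=
    hI.bdd_mul hc.aestronglyMeasurable (.of_forall hK)
  have h2 : Integrable (fun r => (ψ r - t) ^ 2 * rootGammaDensity z r) := by
    refine hI.bdd_mul (c := (K + |t|) ^ 2) (by fun_prop) (.of_forall fun r => ?_)
    rw [Real.norm_eq_abs, abs_pow]
    gcongr
    exact (abs_sub _ _).trans (by gcongr; exact hK r)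
  set m := ∫ r, ψ r * rootGammaDensity z r with hm
  have h3 : ∫ r, (ψ r - m) ^ 2 * rootGammaDensity z r =
      (∫ r, (ψ r - t) ^ 2 * rootGammaDensity z r) - (m - t) ^ 2 := by
    have : ∀ r, (ψ r - m) ^ 2 * rootGammaDensity z r = (ψ r - t) ^ 2 * rootGammaDensity z r -
        (2 * (m - t) * (ψ r * rootGammaDensity z r) - (m ^ 2 - t ^ 2) * rootGammaDensity z r) := by
      intro r; ring
    simp_rw [this]
    have h5 : Integrable (fun r => 2 * (m - t) * (ψ r * rootGammaDensity z r) -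
        (m ^ 2 - t ^ 2) * rootGammaDensity z r) := (h1.const_mul _).sub (hI.const_mul _)
    rw [integral_sub h2 h5, integral_sub (h1.const_mul _) (hI.const_mul _),
      integral_const_mul, integral_const_mul,
      integral_rootGammaDensity, ← hm]
    ring
  have h4 : 0 ≤ ∫ r, (ψ r - m) ^ 2 * rootGammaDensity z r :=
    integral_nonneg fun r => mul_nonneg (sq_nonneg _) (rootGammaDensity_nonneg z r)
  linarith

/-- The conditional expectation of `φ` given the Poisson count: its mean is the Gaussian mean of
`φ`, and its mean squared error is at most the Gaussian one. -/
lemma poisson_gaussian_transfer {φ : ℝ → ℝ} (hc : Continuous φ) {K : ℝ}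
    (hK : ∀ r, |φ r| ≤ K) (he : ∀ r, φ (-r) = φ r) {lam u : ℝ} (hu : u ^ 2 = lam) (t : ℝ) :
    MemLp (fun z : ℕ => ∫ r, φ r * rootGammaDensity z r) 2 (poissonMeasure lam.toNNReal) ∧
    ∫ z, (∫ r, φ r * rootGammaDensity z r) ∂(poissonMeasure lam.toNNReal) =
      ∫ r, φ r ∂(gaussianReal u (1 / 2)) ∧
    ∫ z, ((∫ r, φ r * rootGammaDensity z r) - t) ^ 2 ∂(poissonMeasure lam.toNNReal) ≤
      ∫ r, (φ r - t) ^ 2 ∂(gaussianReal u (1 / 2)) := by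
  have hlam : 0 ≤ lam := hu ▸ sq_nonneg u
  have hbd : ∀ z : ℕ, ‖∫ r, φ r * rootGammaDensity z r‖ ≤ K := by
    intro z
    refine (norm_integral_le_of_norm_le ((integrable_rootGammaDensity z).const_mul K)
      (.of_forall fun r => ?_)).trans_eq
      (by rw [integral_const_mul, integral_rootGammaDensity, mul_one])
    rw [norm_mul, Real.norm_eq_abs, Real.norm_eq_abs, abs_of_nonneg (rootGammaDensity_nonneg z r)]
    exact mul_le_mul_of_nonneg_right (hK r) (rootGammaDensity_nonneg z r)
  have hmem : MemLp (fun z : ℕ => ∫ r, φ r * rootGammaDensity z r) 2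
      (poissonMeasure lam.toNNReal) :=
    MemLp.of_bound .of_discrete K (.of_forall hbd)
  have hlam' : ((lam.toNNReal : ℝ≥0) : ℝ) = u ^ 2 := by rw [Real.coe_toNNReal _ hlam, hu]
  refine ⟨hmem, ?_, ?_⟩
  · have h1 := hasSum_integral_poissonMeasure (hmem.integrable (by norm_num))
    rw [hlam'] at h1
    exact h1.unique (hasSum_integral_mul_rootGammaDensity hc hK he u)
  · have h1 := hasSum_integral_poissonMeasure
      ((hmem.sub (memLp_const t)).integrable_sq)
    rw [hlam'] at h1
    have h2 := hasSum_integral_mul_rootGammaDensity (ψ := fun r => (φ r - t) ^ 2) (by fun_prop)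
      (K := (K + |t|) ^ 2) (fun r => by
        rw [abs_pow]
        gcongr
        exact (abs_sub _ _).trans (by gcongr; exact hK r)) (fun r => by rw [he]) u
    refine hasSum_le (fun z => ?_) h1 h2
    simp only [smul_eq_mul, Pi.sub_apply]
    gcongr
    exact sq_integral_mul_rootGammaDensity_le hc hK z t

lemma one_sub_cos_nonneg (x : ℝ) : 0 ≤ 1 - Real.cos x := by linarith [Real.cos_le_one x]

lemma one_sub_cos_mul_rpow_le {β s : ℝ} (hs : 0 < s) (u : ℝ) :
    (1 - Real.cos (s * u)) * s ^ (-1 - β) ≤ u ^ 2 / 2 * s ^ (1 - β) := by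
  have h1 : 1 - Real.cos (s * u) ≤ (s * u) ^ 2 / 2 := by
    linarith [Real.one_sub_sq_div_two_le_cos (x := s * u)]
  have h2 : s ^ (1 - β) = s ^ 2 * s ^ (-1 - β) := by
    rw [← Real.rpow_natCast, ← Real.rpow_add hs]; congr 1; push_cast; ring
  rw [h2]
  have := mul_le_mul_of_nonneg_right h1 (Real.rpow_nonneg hs.le (-1 - β))
  linarith

lemma one_sub_cos_mul_rpow_le_two {β s : ℝ} (hs : 0 < s) (u : ℝ) :
    (1 - Real.cos (s * u)) * s ^ (-1 - β) ≤ 2 * s ^ (-1 - β) :=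
  mul_le_mul_of_nonneg_right (by linarith [Real.neg_one_le_cos (s * u)])
    (Real.rpow_nonneg hs.le _)

lemma one_sub_cos_mul_rpow_nonneg {β s : ℝ} (hs : 0 < s) (u : ℝ) :
    0 ≤ (1 - Real.cos (s * u)) * s ^ (-1 - β) :=
  mul_nonneg (one_sub_cos_nonneg _) (Real.rpow_nonneg hs.le _)

lemma continuousOn_one_sub_cos_mul_rpow (β u : ℝ) :
    ContinuousOn (fun s : ℝ => (1 - Real.cos (s * u)) * s ^ (-1 - β)) (Set.Ioi 0) := by
  refine ContinuousOn.mul (by fun_prop) ?_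
  exact fun s hs => (Real.continuousAt_rpow_const s _ (Or.inl (ne_of_gt hs))).continuousWithinAt

lemma integrableOn_one_sub_cos_mul_rpow {β : ℝ} (h0 : 0 < β) (h1 : β ≤ 1) (u : ℝ) :
    IntegrableOn (fun s : ℝ => (1 - Real.cos (s * u)) * s ^ (-1 - β)) (Set.Ioi 0) := by
  have hm : AEStronglyMeasurable (fun s : ℝ => (1 - Real.cos (s * u)) * s ^ (-1 - β))
      (volume.restrict (Set.Ioi 0)) :=
    (continuousOn_one_sub_cos_mul_rpow β u).aestronglyMeasurable measurableSet_Ioi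
  rw [← Set.Ioc_union_Ioi_eq_Ioi (zero_le_one : (0:ℝ) ≤ 1)]
  refine IntegrableOn.union ?_ ?_
  · have hi : IntegrableOn (fun s : ℝ => u ^ 2 / 2 * s ^ (1 - β)) (Set.Ioc 0 1) := by
      have := (intervalIntegral.intervalIntegrable_rpow' (a := 0) (b := 1)
        (show -1 < 1 - β by linarith)).const_mul (u ^ 2 / 2)
      rwa [intervalIntegrable_iff_integrableOn_Ioc_of_le zero_le_one] at this
    refine Integrable.mono' hi (hm.mono_set Set.Ioc_subset_Ioi_self) ?_
    refine (ae_restrict_iff' measurableSet_Ioc).2 (ae_of_all _ fun s hs => ?_)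
    rw [Real.norm_of_nonneg (one_sub_cos_mul_rpow_nonneg hs.1 u)]
    exact one_sub_cos_mul_rpow_le hs.1 u
  · have hi : IntegrableOn (fun s : ℝ => 2 * s ^ (-1 - β)) (Set.Ioi 1) :=
      (integrableOn_Ioi_rpow_of_lt (by linarith) one_pos).const_mul 2
    refine Integrable.mono' hi (hm.mono_set (Set.Ioi_subset_Ioi zero_le_one)) ?_
    refine (ae_restrict_iff' measurableSet_Ioi).2 (ae_of_all _ fun s hs => ?_)
    have hs : 0 < s := lt_trans one_pos hs
    rw [Real.norm_of_nonneg (one_sub_cos_mul_rpow_nonneg hs u)]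
    exact one_sub_cos_mul_rpow_le_two hs u

lemma integral_one_sub_cos_mul_rpow_pos {β : ℝ} (h0 : 0 < β) (h1 : β ≤ 1) :
    0 < ∫ s in Set.Ioi (0:ℝ), (1 - Real.cos (s * 1)) * s ^ (-1 - β) := by
  have hi := integrableOn_one_sub_cos_mul_rpow h0 h1 1
  rw [setIntegral_pos_iff_support_of_nonneg_ae ?_ hi]
  · have hsub : Set.Ioo (0:ℝ) 1 ⊆
        (Function.support fun s : ℝ => (1 - Real.cos (s * 1)) * s ^ (-1 - β)) ∩ Set.Ioi 0 := by
      intro s hs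
      refine ⟨?_, hs.1⟩
      have : Real.cos s < 1 := by
        have := Real.cos_lt_cos_of_nonneg_of_le_pi le_rfl
          (by linarith [hs.2, Real.pi_gt_three]) hs.1
        simpa using this
      simp only [Function.mem_support, mul_one]
      exact (mul_pos (by linarith) (Real.rpow_pos_of_pos hs.1 _)).ne'
    refine lt_of_lt_of_le ?_ (measure_mono hsub)
    simp
  · refine (ae_restrict_iff' measurableSet_Ioi).2 (ae_of_all _ fun s hs => ?_)
    exact one_sub_cos_mul_rpow_nonneg hs 1

lemma integral_one_sub_cos_mul_rpow {β : ℝ} (h0 : 0 < β) {u : ℝ} (hu : 0 ≤ u) :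
    ∫ s in Set.Ioi (0:ℝ), (1 - Real.cos (s * u)) * s ^ (-1 - β) =
      u ^ β * ∫ s in Set.Ioi (0:ℝ), (1 - Real.cos (s * 1)) * s ^ (-1 - β) := by
  rcases hu.eq_or_lt with rfl | hu
  · simp [Real.zero_rpow h0.ne']
  have h := integral_comp_mul_left_Ioi
    (fun s : ℝ => (1 - Real.cos (s * 1)) * s ^ (-1 - β)) 0 hu
  rw [mul_zero] at h
  have h2 : ∫ s in Set.Ioi (0:ℝ), (1 - Real.cos (u * s * 1)) * (u * s) ^ (-1 - β) =
      u ^ (-1 - β) * ∫ s in Set.Ioi (0:ℝ), (1 - Real.cos (s * u)) * s ^ (-1 - β) := by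
    rw [← integral_const_mul]
    refine setIntegral_congr_fun measurableSet_Ioi fun s hs => ?_
    rw [Real.mul_rpow hu.le (le_of_lt hs), mul_one, mul_comm u s]
    ring
  rw [h2, smul_eq_mul] at h
  have h4 : u ^ (1 + β) * u ^ (-1 - β) = 1 := by
    rw [← Real.rpow_add hu]; simp
  have h5 : u ^ (1 + β) * u⁻¹ = u ^ β := by
    rw [Real.rpow_add hu, Real.rpow_one]; field_simp
  calc _ = u ^ (1 + β) * (u ^ (-1 - β) *
        ∫ s in Set.Ioi (0:ℝ), (1 - Real.cos (s * u)) * s ^ (-1 - β)) := by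
        rw [← mul_assoc, h4, one_mul]
    _ = _ := by rw [h, ← mul_assoc, h5]

lemma abs_intervalIntegral_sub_integral_one_sub_cos {β : ℝ} (h0 : 0 < β) (h1 : β ≤ 1)
    {τ a : ℝ} (hτ : 0 < τ) (hτ1 : τ ≤ 1) (ha : 1 ≤ a) (u : ℝ) :
    |(∫ s in τ..a, (1 - Real.cos (s * u)) * s ^ (-1 - β)) -
      ∫ s in Set.Ioi (0:ℝ), (1 - Real.cos (s * u)) * s ^ (-1 - β)| ≤
      u ^ 2 * τ + 2 / β * a ^ (-β) := by
  have hi := integrableOn_one_sub_cos_mul_rpow h0 h1 u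
  have hτa : τ ≤ a := hτ1.trans ha
  have ha0 : 0 < a := by linarith
  have e1 : ∫ s in Set.Ioi (0:ℝ), (1 - Real.cos (s * u)) * s ^ (-1 - β) =
      (∫ s in Set.Ioc 0 τ, (1 - Real.cos (s * u)) * s ^ (-1 - β)) +
      ((∫ s in τ..a, (1 - Real.cos (s * u)) * s ^ (-1 - β)) +
        ∫ s in Set.Ioi a, (1 - Real.cos (s * u)) * s ^ (-1 - β)) := by
    rw [intervalIntegral.integral_of_le hτa,
      ← setIntegral_union (Set.Ioc_disjoint_Ioi le_rfl) measurableSet_Ioi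
        (hi.mono_set fun s hs => hτ.trans hs.1) (hi.mono_set fun s hs => ha0.trans hs),
      Set.Ioc_union_Ioi_eq_Ioi hτa,
      ← setIntegral_union (Set.Ioc_disjoint_Ioi le_rfl) measurableSet_Ioi
        (hi.mono_set fun s hs => hs.1) (hi.mono_set fun s hs => hτ.trans hs),
      Set.Ioc_union_Ioi_eq_Ioi hτ.le]
  have n1 : 0 ≤ ∫ s in Set.Ioc 0 τ, (1 - Real.cos (s * u)) * s ^ (-1 - β) :=
    setIntegral_nonneg measurableSet_Ioc fun s hs => one_sub_cos_mul_rpow_nonneg hs.1 u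
  have n2 : 0 ≤ ∫ s in Set.Ioi a, (1 - Real.cos (s * u)) * s ^ (-1 - β) :=
    setIntegral_nonneg measurableSet_Ioi
      fun s hs => one_sub_cos_mul_rpow_nonneg (ha0.trans hs) u
  have b1 : ∫ s in Set.Ioc 0 τ, (1 - Real.cos (s * u)) * s ^ (-1 - β) ≤ u ^ 2 * τ := by
    calc _ ≤ ∫ s in Set.Ioc 0 τ, u ^ 2 := by
          refine setIntegral_mono_on (hi.mono_set fun s hs => hs.1) (by simp)
            measurableSet_Ioc fun s hs => ?_
          refine (one_sub_cos_mul_rpow_le hs.1 u).trans ?_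
          have : s ^ (1 - β) ≤ 1 :=
            Real.rpow_le_one hs.1.le (hs.2.trans hτ1) (by linarith)
          nlinarith [sq_nonneg u]
      _ = u ^ 2 * τ := by simp [hτ.le, mul_comm]
  have b2 : ∫ s in Set.Ioi a, (1 - Real.cos (s * u)) * s ^ (-1 - β) ≤ 2 / β * a ^ (-β) := by
    calc _ ≤ ∫ s in Set.Ioi a, 2 * s ^ (-1 - β) := by
          refine setIntegral_mono_on (hi.mono_set fun s hs => ha0.trans hs)
            ((integrableOn_Ioi_rpow_of_lt (by linarith) ha0).const_mul 2)
            measurableSet_Ioi fun s hs => one_sub_cos_mul_rpow_le_two (ha0.trans hs) u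
      _ = _ := by
          rw [integral_const_mul, integral_Ioi_rpow_of_lt (by linarith) ha0,
            show -1 - β + 1 = -β by ring]
          field_simp
  rw [e1, abs_le]
  constructor <;> linarith

lemma integral_cos_gaussianReal (u s : ℝ) :
    ∫ r, Real.cos (s * r) ∂(gaussianReal u (1 / 2)) =
      Real.exp (-(s ^ 2 / 4)) * Real.cos (s * u) := by
  have h := charFun_gaussianReal (μ := u) (v := 1 / 2) s
  rw [charFun_apply_real] at h
  have h2 := congrArg Complex.re h
  have hre : ∀ r : ℝ, (Complex.exp (s * r * Complex.I)).re = Real.cos (s * r) := by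
    intro r
    rw [← Complex.ofReal_mul, Complex.exp_ofReal_mul_I_re]
  have h_int : Integrable (fun r : ℝ => Complex.exp (s * r * Complex.I))
      (gaussianReal u (1 / 2)) := by
    refine Integrable.of_bound (by fun_prop) 1 (ae_of_all _ fun r => ?_)
    rw [← Complex.ofReal_mul, Complex.norm_exp_ofReal_mul_I]
  rw [← RCLike.re_eq_complex_re, ← integral_re h_int] at h2
  simp only [RCLike.re_eq_complex_re, hre] at h2
  rw [h2]
  have : (s : ℂ) * u * Complex.I - ((1 / 2 : ℝ≥0) : ℝ) * s ^ 2 / 2 =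
      ((-(s ^ 2 / 4) : ℝ) : ℂ) + ((s * u : ℝ) : ℂ) * Complex.I := by
    push_cast; ring
  rw [this, Complex.exp_add, ← Complex.ofReal_exp, Complex.re_ofReal_mul,
    Complex.exp_ofReal_mul_I_re]

/-- A bounded even function whose mean under the Gaussian law `N(u, 1/2)` is the truncation
`∫ s in τ..a, (1 - cos (s * u)) * s ^ (-1 - β)` of the integral representing `|u| ^ β`. -/
noncomputable def deconvolvedPower (β τ a r : ℝ) : ℝ :=
  ∫ s in τ..a, (1 - Real.exp (s ^ 2 / 4) * Real.cos (s * r)) * max s τ ^ (-1 - β)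

lemma continuous_max_rpow {τ : ℝ} (hτ : 0 < τ) (p : ℝ) :
    Continuous (fun s : ℝ => max s τ ^ p) :=
  Continuous.rpow_const (by fun_prop) fun s => Or.inl (hτ.trans_le (le_max_right s τ)).ne'

lemma continuous_deconvolvedPower_integrand {β τ : ℝ} (hτ : 0 < τ) :
    Continuous (fun p : ℝ × ℝ =>
      (1 - Real.exp (p.2 ^ 2 / 4) * Real.cos (p.2 * p.1)) * max p.2 τ ^ (-1 - β)) := by
  have := (continuous_max_rpow hτ (-1 - β)).comp (continuous_snd (X := ℝ) (Y := ℝ))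
  exact Continuous.mul (by fun_prop) this

lemma continuous_deconvolvedPower {β τ a : ℝ} (hτ : 0 < τ) :
    Continuous (deconvolvedPower β τ a) :=
  intervalIntegral.continuous_parametric_intervalIntegral_of_continuous'
    (continuous_deconvolvedPower_integrand hτ) τ a

lemma deconvolvedPower_neg (β τ a r : ℝ) :
    deconvolvedPower β τ a (-r) = deconvolvedPower β τ a r := by
  simp [deconvolvedPower]

lemma abs_deconvolvedPower_integrand_le {β τ : ℝ} (hτ : 0 < τ) (r s : ℝ) :
    |(1 - Real.exp (s ^ 2 / 4) * Real.cos (s * r)) * max s τ ^ (-1 - β)| ≤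
      (1 + Real.exp (s ^ 2 / 4)) * max s τ ^ (-1 - β) := by
  have hk : 0 ≤ max s τ ^ (-1 - β) := Real.rpow_nonneg (hτ.le.trans (le_max_right s τ)) _
  rw [abs_mul, abs_of_nonneg hk]
  refine mul_le_mul_of_nonneg_right ?_ hk
  refine (abs_sub _ _).trans ?_
  rw [abs_one, abs_mul, abs_of_pos (Real.exp_pos _)]
  have := Real.abs_cos_le_one (s * r)
  nlinarith [Real.exp_pos (s ^ 2 / 4)]

lemma continuous_deconvolvedPower_bound {β τ : ℝ} (hτ : 0 < τ) :
    Continuous (fun s : ℝ => (1 + Real.exp (s ^ 2 / 4)) * max s τ ^ (-1 - β)) :=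
  Continuous.mul (by fun_prop) (continuous_max_rpow hτ _)

lemma abs_deconvolvedPower_le {β τ a : ℝ} (hτ : 0 < τ) (h : τ ≤ a) (r : ℝ) :
    |deconvolvedPower β τ a r| ≤
      ∫ s in τ..a, (1 + Real.exp (s ^ 2 / 4)) * max s τ ^ (-1 - β) := by
  rw [← Real.norm_eq_abs, deconvolvedPower]
  exact intervalIntegral.norm_integral_le_of_norm_le h
    (ae_of_all _ fun s _ => abs_deconvolvedPower_integrand_le hτ r s)
    ((continuous_deconvolvedPower_bound hτ).intervalIntegrable _ _)

lemma integral_deconvolvedPower {β τ a : ℝ} (hτ : 0 < τ) (h : τ ≤ a) (u : ℝ) :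
    ∫ r, deconvolvedPower β τ a r ∂(gaussianReal u (1 / 2)) =
      ∫ s in τ..a, (1 - Real.cos (s * u)) * s ^ (-1 - β) := by
  simp only [deconvolvedPower, intervalIntegral.integral_of_le h]
  rw [integral_integral_swap]
  · refine setIntegral_congr_fun measurableSet_Ioc fun s hs => ?_
    rw [integral_mul_const, integral_sub (integrable_const _), integral_const_mul,
      integral_cos_gaussianReal, ← mul_assoc, ← Real.exp_add, max_eq_left hs.1.le]
    · simp
    · refine Integrable.of_bound (by fun_prop) (Real.exp (s ^ 2 / 4)) (ae_of_all _ fun r => ?_)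
      rw [norm_mul, Real.norm_of_nonneg (Real.exp_pos _).le]
      exact mul_le_of_le_one_right (Real.exp_pos _).le (Real.abs_cos_le_one _)
  · have hb : Integrable (fun p : ℝ × ℝ => (1:ℝ) *
        ((1 + Real.exp (p.2 ^ 2 / 4)) * max p.2 τ ^ (-1 - β)))
        ((gaussianReal u (1 / 2)).prod (volume.restrict (Set.Ioc τ a))) :=
      Integrable.mul_prod (integrable_const 1)
        (((continuous_deconvolvedPower_bound hτ).integrableOn_Icc).mono_set
          Set.Ioc_subset_Icc_self)
    refine hb.mono' (continuous_deconvolvedPower_integrand hτ).aestronglyMeasurable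
      (ae_of_all _ fun p => ?_)
    rw [one_mul]
    exact abs_deconvolvedPower_integrand_le hτ p.1 p.2

lemma abs_exp_mul_cos_sub_cos_le {s a : ℝ} (hs : 0 ≤ s) (ha : s ≤ a) (r u : ℝ) :
    |Real.exp (s ^ 2 / 4) * Real.cos (s * r) - Real.cos (s * u)| ≤
      Real.exp (a ^ 2 / 4) * (s * |r - u| + s ^ 2) := by
  have hE : Real.exp (s ^ 2 / 4) ≤ Real.exp (a ^ 2 / 4) := by
    apply Real.exp_le_exp.2; nlinarith
  have h1 : |Real.cos (s * r) - Real.cos (s * u)| ≤ s * |r - u| := by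
    have := Real.abs_cos_sub_cos_le (s * r) (s * u)
    rwa [← mul_sub, abs_mul, abs_of_nonneg hs] at this
  have h2 : Real.exp (s ^ 2 / 4) - 1 ≤ Real.exp (s ^ 2 / 4) * s ^ 2 := by
    have h := Real.add_one_le_exp (-(s ^ 2 / 4))
    have h' := mul_le_mul_of_nonneg_left h (Real.exp_pos (s ^ 2 / 4)).le
    rw [← Real.exp_add, add_neg_cancel, Real.exp_zero] at h'
    nlinarith [mul_nonneg (Real.exp_pos (s ^ 2 / 4)).le (sq_nonneg s)]
  have h3 : 1 ≤ Real.exp (s ^ 2 / 4) := Real.one_le_exp (by positivity)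
  calc _ = |Real.exp (s ^ 2 / 4) * (Real.cos (s * r) - Real.cos (s * u)) +
        (Real.exp (s ^ 2 / 4) - 1) * Real.cos (s * u)| := by congr 1; ring
    _ ≤ Real.exp (s ^ 2 / 4) * (s * |r - u|) + Real.exp (s ^ 2 / 4) * s ^ 2 := by
        refine (abs_add_le _ _).trans (add_le_add ?_ ?_)
        · rw [abs_mul, abs_of_pos (Real.exp_pos _)]
          exact mul_le_mul_of_nonneg_left h1 (Real.exp_pos _).le
        · rw [abs_mul, abs_of_nonneg (by linarith)]
          exact (mul_le_of_le_one_right (by linarith) (Real.abs_cos_le_one _)).trans h2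
    _ ≤ _ := by
        rw [← mul_add]
        exact mul_le_mul_of_nonneg_right hE (by positivity)

lemma abs_deconvolvedPower_sub_le {β τ a : ℝ} (h0 : 0 < β) (h1 : β ≤ 1) (hτ : 0 < τ)
    (h : τ ≤ a) (u r : ℝ) :
    |deconvolvedPower β τ a r - ∫ s in τ..a, (1 - Real.cos (s * u)) * s ^ (-1 - β)| ≤
      Real.exp (a ^ 2 / 4) * (Real.log (a / τ) + a + a * (1 + a)) * (|r - u| + 1) := by
  have ha0 : 0 < a := hτ.trans_le h
  have hL : 0 ≤ Real.log (a / τ) := Real.log_nonneg ((one_le_div hτ).2 h)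
  have e1 : ∫ s in τ..a, (1 - Real.cos (s * u)) * s ^ (-1 - β) =
      ∫ s in τ..a, (1 - Real.cos (s * u)) * max s τ ^ (-1 - β) := by
    refine intervalIntegral.integral_congr fun s hs => ?_
    rw [Set.uIcc_of_le h] at hs
    simp only [max_eq_left hs.1]
  have c1 : Continuous fun s : ℝ =>
      (1 - Real.exp (s ^ 2 / 4) * Real.cos (s * r)) * max s τ ^ (-1 - β) :=
    Continuous.mul (by fun_prop) (continuous_max_rpow hτ _)
  have c2 : Continuous fun s : ℝ => (1 - Real.cos (s * u)) * max s τ ^ (-1 - β) :=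
    Continuous.mul (by fun_prop) (continuous_max_rpow hτ _)
  rw [e1, deconvolvedPower, ← intervalIntegral.integral_sub (c1.intervalIntegrable _ _)
    (c2.intervalIntegrable _ _)]
  have hii : IntervalIntegrable (fun s : ℝ => s⁻¹) volume τ a := by
    refine intervalIntegral.intervalIntegrable_inv (fun s hs => ?_) continuousOn_id
    rw [Set.uIcc_of_le h] at hs
    exact (hτ.trans_le hs.1).ne'
  have hi : IntervalIntegrable (fun s : ℝ => Real.exp (a ^ 2 / 4) *
      (|r - u| * (s⁻¹ + 1) + (1 + a))) volume τ a :=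
    ((((hii.add intervalIntegrable_const).const_mul _).add intervalIntegrable_const).const_mul _)
  rw [← Real.norm_eq_abs]
  refine (intervalIntegral.norm_integral_le_of_norm_le (g := fun s : ℝ => Real.exp (a ^ 2 / 4) *
      (|r - u| * (s⁻¹ + 1) + (1 + a))) h (ae_of_all _ fun s hs => ?_) hi).trans ?_
  · have hs0 : 0 < s := hτ.trans hs.1
    have hk : 0 ≤ s ^ (-1 - β) := Real.rpow_nonneg hs0.le _
    have hk1 : s * s ^ (-1 - β) ≤ s⁻¹ + 1 := by
      have : s * s ^ (-1 - β) = s ^ (-β) := by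
        nth_rewrite 1 [← Real.rpow_one s]
        rw [← Real.rpow_add hs0]; congr 1; ring
      rw [this]
      rcases le_total s 1 with h' | h'
      · have := Real.rpow_le_rpow_of_exponent_ge hs0 h' (show (-1:ℝ) ≤ -β by linarith)
        rw [Real.rpow_neg_one] at this
        linarith
      · have := Real.rpow_le_one_of_one_le_of_nonpos h' (show -β ≤ 0 by linarith)
        have := inv_pos.2 hs0
        linarith
    have hk2 : s ^ 2 * s ^ (-1 - β) ≤ 1 + a := by
      calc _ = s * (s * s ^ (-1 - β)) := by ring
        _ ≤ s * (s⁻¹ + 1) := mul_le_mul_of_nonneg_left hk1 hs0.le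
        _ = 1 + s := by field_simp
        _ ≤ _ := by linarith [hs.2]
    rw [max_eq_left hs.1.le, Real.norm_eq_abs, ← sub_mul, abs_mul, abs_of_nonneg hk, abs_sub_comm]
    rw [show 1 - Real.cos (s * u) - (1 - Real.exp (s ^ 2 / 4) * Real.cos (s * r)) =
      Real.exp (s ^ 2 / 4) * Real.cos (s * r) - Real.cos (s * u) by ring]
    refine (mul_le_mul_of_nonneg_right (abs_exp_mul_cos_sub_cos_le hs0.le hs.2 r u) hk).trans ?_
    rw [mul_assoc]
    refine mul_le_mul_of_nonneg_left ?_ (Real.exp_pos _).le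
    have := mul_le_mul_of_nonneg_left hk1 (abs_nonneg (r - u))
    linarith
  · rw [intervalIntegral.integral_const_mul, intervalIntegral.integral_add
      ((hii.add intervalIntegrable_const).const_mul _) intervalIntegrable_const,
      intervalIntegral.integral_const_mul,
      intervalIntegral.integral_add hii intervalIntegrable_const,
      integral_inv_of_pos hτ ha0, intervalIntegral.integral_const,
      intervalIntegral.integral_const, mul_assoc]
    refine mul_le_mul_of_nonneg_left ?_ (Real.exp_pos _).le
    have hr := abs_nonneg (r - u)
    simp only [smul_eq_mul, mul_one]
    nlinarith [mul_nonneg hr hτ.le, mul_nonneg hr ha0.le, mul_nonneg hr hL,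
      mul_nonneg hr (mul_nonneg ha0.le (by linarith : 0 ≤ 1 + a)),
      mul_nonneg hτ.le ha0.le]

lemma integral_sub_mean_sq_gaussianReal (u : ℝ) :
    ∫ r, (r - u) ^ 2 ∂(gaussianReal u (1 / 2)) = 1 / 2 := by
  have h := variance_fun_id_gaussianReal (μ := u) (v := 1 / 2)
  rw [variance_eq_integral (by fun_prop)] at h
  simpa [integral_id_gaussianReal] using h

lemma exists_gaussian_unbiased_power {β : ℝ} (h0 : 0 < β) (h1 : β ≤ 1) :
    ∃ C : ℝ, 0 < C ∧ ∀ τ a : ℝ, 0 < τ → τ ≤ 1 → 1 ≤ a →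
      ∃ φ : ℝ → ℝ, Continuous φ ∧ (∃ K, ∀ r, |φ r| ≤ K) ∧ (∀ r, φ (-r) = φ r) ∧
        ∀ u : ℝ, 0 ≤ u →
          |∫ r, φ r ∂(gaussianReal u (1 / 2)) - u ^ β| ≤ C * (u ^ 2 * τ + a ^ (-β)) ∧
          ∫ r, (φ r - u ^ β) ^ 2 ∂(gaussianReal u (1 / 2)) ≤
            C * ((Real.exp (a ^ 2 / 4) * (Real.log (a / τ) + a + a * (1 + a))) ^ 2 +
              (u ^ 2 * τ + a ^ (-β)) ^ 2) := by
  set I : ℝ := ∫ s in Set.Ioi (0:ℝ), (1 - Real.cos (s * 1)) * s ^ (-1 - β) with hI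
  have hIpos : 0 < I := integral_one_sub_cos_mul_rpow_pos h0 h1
  set c : ℝ := I⁻¹ with hc
  have hcpos : 0 < c := inv_pos.2 hIpos
  set C : ℝ := c * (1 + 2 / β) with hC
  have hCpos : 0 < C := by positivity
  refine ⟨C + 6 * c ^ 2 + 2 * C ^ 2, by positivity, fun τ a hτ hτ1 ha => ?_⟩
  have hτa : τ ≤ a := hτ1.trans ha
  have ha0 : 0 < a := by linarith
  refine ⟨fun r => c * deconvolvedPower β τ a r,
    continuous_const.mul (continuous_deconvolvedPower hτ),
    ⟨c * ∫ s in τ..a, (1 + Real.exp (s ^ 2 / 4)) * max s τ ^ (-1 - β), fun r => ?_⟩,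
    fun r => by simp only [deconvolvedPower_neg], fun u hu => ?_⟩
  · rw [abs_mul, abs_of_pos hcpos]
    exact mul_le_mul_of_nonneg_left (abs_deconvolvedPower_le hτ hτa r) hcpos.le
  set v : ℝ := ∫ s in τ..a, (1 - Real.cos (s * u)) * s ^ (-1 - β) with hv
  set X : ℝ := u ^ 2 * τ + a ^ (-β) with hX
  set E : ℝ := Real.exp (a ^ 2 / 4) * (Real.log (a / τ) + a + a * (1 + a)) with hE
  have hX0 : 0 ≤ X := by positivity
  have hbias : |c * v - u ^ β| ≤ C * X := by
    have hb := abs_intervalIntegral_sub_integral_one_sub_cos h0 h1 hτ hτ1 ha u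
    rw [integral_one_sub_cos_mul_rpow h0 hu, ← hI, ← hv] at hb
    have e : c * v - u ^ β = c * (v - u ^ β * I) := by
      rw [hc]; field_simp
    rw [e, abs_mul, abs_of_pos hcpos, hC, mul_assoc]
    refine mul_le_mul_of_nonneg_left (hb.trans ?_) hcpos.le
    have : 0 ≤ 2 / β * (u ^ 2 * τ) := by positivity
    have : 0 ≤ a ^ (-β) := by positivity
    rw [hX]
    linarith
  constructor
  · rw [integral_const_mul, integral_deconvolvedPower hτ hτa]
    refine hbias.trans (mul_le_mul_of_nonneg_right ?_ hX0)
    nlinarith [sq_nonneg c, sq_nonneg C]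
  · have hsq : Integrable (fun r => (r - u) ^ 2) (gaussianReal u (1 / 2)) := by
      refine MemLp.integrable_sq ?_
      exact (memLp_id_gaussianReal 2).sub (memLp_const u)
    calc ∫ r, (c * deconvolvedPower β τ a r - u ^ β) ^ 2 ∂(gaussianReal u (1 / 2))
        ≤ ∫ r, (4 * (c * E) ^ 2 * (r - u) ^ 2 + (4 * (c * E) ^ 2 + 2 * (C * X) ^ 2))
            ∂(gaussianReal u (1 / 2)) := by
          refine integral_mono_of_nonneg (ae_of_all _ fun r => sq_nonneg _)
            ((hsq.const_mul _).add (integrable_const _)) (ae_of_all _ fun r => ?_)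
          have h2 := abs_deconvolvedPower_sub_le h0 h1 hτ hτa u r
          rw [← hv, ← hE] at h2
          have h3 : (deconvolvedPower β τ a r - v) ^ 2 ≤ E ^ 2 * (2 * (r - u) ^ 2 + 2) := by
            have := pow_le_pow_left₀ (abs_nonneg _) h2 2
            rw [sq_abs, mul_pow] at this
            refine this.trans (mul_le_mul_of_nonneg_left ?_ (sq_nonneg _))
            nlinarith [sq_abs (r - u), sq_nonneg (|r - u| - 1)]
          have h4 : (c * v - u ^ β) ^ 2 ≤ (C * X) ^ 2 := by
            rw [← sq_abs]
            exact pow_le_pow_left₀ (abs_nonneg _) hbias 2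
          have h5 := mul_le_mul_of_nonneg_left h3 (sq_nonneg c)
          simp only
          nlinarith [sq_nonneg (c * (deconvolvedPower β τ a r - v) - (c * v - u ^ β))]
      _ = 6 * c ^ 2 * E ^ 2 + 2 * C ^ 2 * X ^ 2 := by
          rw [integral_add (hsq.const_mul _) (integrable_const _), integral_const_mul,
            integral_sub_mean_sq_gaussianReal]
          simp
          ring
      _ ≤ _ := by
          have := mul_nonneg hCpos.le (sq_nonneg E)
          have := mul_nonneg hCpos.le (sq_nonneg X)
          have := mul_nonneg (sq_nonneg C) (sq_nonneg E)
          have := mul_nonneg (sq_nonneg c) (sq_nonneg X)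
          clear_value C E X c
          linarith

set_option maxHeartbeats 800000 in
lemma exists_poisson_power_estimator {α c₁ : ℝ} (h0 : 0 < α) (h1 : α ≤ 1 / 2) (hc : 0 < c₁) :
    ∃ C : ℝ, 0 < C ∧ ∀ n : ℕ, 2 ≤ n → ∃ g : ℕ → ℝ, ∀ lam : ℝ, 0 ≤ lam → lam ≤ n →
      MemLp g 2 (poissonMeasure lam.toNNReal) ∧
      |(∫ z, g z ∂(poissonMeasure lam.toNNReal)) - lam ^ α| ≤ C * Real.log n ^ (-α) ∧
      ∫ z, (g z - lam ^ α) ^ 2 ∂(poissonMeasure lam.toNNReal) ≤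
        C * ((n : ℝ) ^ (1 / c₁) * Real.log n ^ (-(2 * α))) := by
  obtain ⟨C, hC, H⟩ := exists_gaussian_unbiased_power (β := 2 * α) (by linarith) (by linarith)
  set κ : ℝ := 1 / (4 * c₁) with hκ
  have hκ0 : 0 < κ := by positivity
  set B : ℝ := 1 + κ ^ (-α) with hB
  set D : ℝ := 4 + (2 + 4 * κ) * κ⁻¹ with hD
  have hB0 : 0 < B := by positivity
  have hD0 : 0 < D := by positivity
  refine ⟨C * B + C * (Real.exp (1 / 2) * D ^ 2 * κ⁻¹ ^ (2 * α) + B ^ 2), by positivity,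
    fun n hn => ?_⟩
  have hn2 : (2:ℝ) ≤ n := by exact_mod_cast hn
  have hn1 : (1:ℝ) ≤ n := by linarith
  have hn0 : (0:ℝ) < n := by linarith
  set l : ℝ := Real.log n with hl
  have hl0 : 0 < l := Real.log_pos (by linarith)
  set a : ℝ := √(1 + κ * l) with ha
  have ha2 : a ^ 2 = 1 + κ * l := Real.sq_sqrt (by positivity)
  have ha1 : 1 ≤ a := by
    rw [ha]; exact Real.one_le_sqrt.2 (by nlinarith)
  have ha0 : 0 < a := by linarith
  set τ : ℝ := 1 / (n : ℝ) ^ 2 with hτ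
  have hτ0 : 0 < τ := by positivity
  have hτ1 : τ ≤ 1 := by
    rw [hτ, div_le_one (by positivity)]; nlinarith
  obtain ⟨φ, hφc, ⟨K, hK⟩, hφe, hφ⟩ := H τ a hτ0 hτ1 ha1
  refine ⟨fun z => ∫ r, φ r * rootGammaDensity z r, fun lam hlam0 hlamn => ?_⟩
  have hu2 : √lam ^ 2 = lam := Real.sq_sqrt hlam0
  have hpow : √lam ^ (2 * α) = lam ^ α := by
    rw [Real.rpow_mul (Real.sqrt_nonneg _), Real.rpow_two, hu2]
  obtain ⟨t1, t2, t3⟩ := poisson_gaussian_transfer hφc hK hφe hu2 (lam ^ α)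
  obtain ⟨g1, g2⟩ := hφ _ (Real.sqrt_nonneg lam)
  rw [hpow, hu2] at g1 g2
  have hnl : ∀ p : ℝ, 0 ≤ p → l ^ p ≤ κ⁻¹ ^ p * (n : ℝ) ^ (κ * p) := by
    intro p hp
    have := Real.log_le_rpow_div hn0.le hκ0
    have := Real.rpow_le_rpow hl0.le this hp
    rwa [Real.div_rpow (by positivity) hκ0.le, ← Real.rpow_mul hn0.le, div_eq_inv_mul,
      ← Real.inv_rpow hκ0.le] at this
  have hX : lam * τ + a ^ (-(2 * α)) ≤ B * l ^ (-α) := by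
    have x1 : lam * τ ≤ l ^ (-α) := by
      calc lam * τ ≤ n * τ := mul_le_mul_of_nonneg_right hlamn hτ0.le
        _ = (n : ℝ)⁻¹ := by rw [hτ]; field_simp
        _ = (n : ℝ) ^ (-1 : ℝ) := by rw [Real.rpow_neg_one]
        _ ≤ (n : ℝ) ^ (-α) := Real.rpow_le_rpow_of_exponent_le hn1 (by linarith)
        _ ≤ l ^ (-α) := Real.rpow_le_rpow_of_nonpos hl0
            ((Real.log_le_sub_one_of_pos hn0).trans (by linarith)) (by linarith)
    have x2 : a ^ (-(2 * α)) ≤ κ ^ (-α) * l ^ (-α) := by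
      rw [show -(2 * α) = 2 * (-α) by ring, Real.rpow_mul ha0.le, Real.rpow_two, ha2,
        ← Real.mul_rpow hκ0.le hl0.le]
      exact Real.rpow_le_rpow_of_nonpos (by positivity) (by linarith) (by linarith)
    rw [hB]; linarith
  have hX0 : 0 ≤ lam * τ + a ^ (-(2 * α)) := by positivity
  refine ⟨t1, ?_, ?_⟩
  · rw [t2]
    refine g1.trans ((mul_le_mul_of_nonneg_left hX hC.le).trans ?_)
    rw [← mul_assoc]
    refine mul_le_mul_of_nonneg_right ?_ (by positivity)
    have : 0 ≤ C * (Real.exp (1 / 2) * D ^ 2 * κ⁻¹ ^ (2 * α) + B ^ 2) := by positivity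
    linarith
  · refine t3.trans (g2.trans ?_)
    have hDn : Real.log (a / τ) + a + a * (1 + a) ≤ D * (n : ℝ) ^ κ := by
      have d1 : Real.log (a / τ) = Real.log a + 2 * l := by
        rw [hτ, div_div_eq_mul_div, div_one, Real.log_mul ha0.ne' (by positivity), Real.log_pow]
        push_cast; ring
      have d2 : Real.log a ≤ a := (Real.log_le_sub_one_of_pos ha0).trans (by linarith)
      have d3 : l ≤ κ⁻¹ * (n : ℝ) ^ κ := by simpa using hnl 1 zero_le_one
      have d4 : 1 ≤ (n : ℝ) ^ κ := Real.one_le_rpow hn1 hκ0.le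
      have d5 : Real.log (a / τ) + a + a * (1 + a) ≤ 4 + (2 + 4 * κ) * l := by
        rw [d1]; nlinarith
      have d6 := mul_le_mul_of_nonneg_left d3 (show 0 ≤ 2 + 4 * κ by positivity)
      rw [hD]
      linarith
    have hD1 : 0 ≤ Real.log (a / τ) + a + a * (1 + a) := by
      have : 0 ≤ Real.log (a / τ) := Real.log_nonneg ((one_le_div hτ0).2 (hτ1.trans ha1))
      positivity
    have e1 : (Real.exp (a ^ 2 / 4)) ^ 2 = Real.exp (1 / 2) * (n : ℝ) ^ (κ / 2) := by
      rw [← Real.exp_nat_mul, Real.rpow_def_of_pos hn0, ← Real.exp_add, ha2]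
      congr 1; push_cast; ring
    have e2 : l ^ (2 * α) * l ^ (-(2 * α)) = 1 := by
      rw [← Real.rpow_add hl0]; simp
    have e3 : (n : ℝ) ^ (κ / 2) * ((n : ℝ) ^ κ) ^ 2 * (n : ℝ) ^ (κ * (2 * α)) ≤
        (n : ℝ) ^ (1 / c₁) := by
      rw [← Real.rpow_natCast, ← Real.rpow_mul hn0.le, ← Real.rpow_add hn0, ← Real.rpow_add hn0]
      refine Real.rpow_le_rpow_of_exponent_le hn1 ?_
      have : 1 / c₁ = 4 * κ := by rw [hκ]; field_simp
      rw [this]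
      have := mul_le_mul_of_nonneg_left h1 hκ0.le
      push_cast
      linarith
    have f1 : (Real.exp (a ^ 2 / 4) * (Real.log (a / τ) + a + a * (1 + a))) ^ 2 ≤
        Real.exp (1 / 2) * D ^ 2 * κ⁻¹ ^ (2 * α) *
          ((n : ℝ) ^ (1 / c₁) * l ^ (-(2 * α))) := by
      calc _ ≤ (Real.exp (1 / 2) * (n : ℝ) ^ (κ / 2)) * (D * (n : ℝ) ^ κ) ^ 2 := by
            rw [mul_pow, e1]
            exact mul_le_mul_of_nonneg_left (pow_le_pow_left₀ hD1 hDn 2) (by positivity)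
        _ = Real.exp (1 / 2) * D ^ 2 * ((n : ℝ) ^ (κ / 2) * ((n : ℝ) ^ κ) ^ 2) *
              (l ^ (2 * α) * l ^ (-(2 * α))) := by rw [e2]; ring
        _ ≤ Real.exp (1 / 2) * D ^ 2 * ((n : ℝ) ^ (κ / 2) * ((n : ℝ) ^ κ) ^ 2) *
              ((κ⁻¹ ^ (2 * α) * (n : ℝ) ^ (κ * (2 * α))) * l ^ (-(2 * α))) := by
            gcongr
            exact hnl _ (by positivity)
        _ = Real.exp (1 / 2) * D ^ 2 * κ⁻¹ ^ (2 * α) * (((n : ℝ) ^ (κ / 2) *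
              ((n : ℝ) ^ κ) ^ 2 * (n : ℝ) ^ (κ * (2 * α))) * l ^ (-(2 * α))) := by ring
        _ ≤ _ := by gcongr
    have f2 : (lam * τ + a ^ (-(2 * α))) ^ 2 ≤
        B ^ 2 * ((n : ℝ) ^ (1 / c₁) * l ^ (-(2 * α))) := by
      calc _ ≤ (B * l ^ (-α)) ^ 2 := pow_le_pow_left₀ hX0 hX 2
        _ = B ^ 2 * (1 * l ^ (-(2 * α))) := by
            rw [mul_pow, ← Real.rpow_natCast (l ^ (-α)), ← Real.rpow_mul hl0.le, one_mul]
            congr 2; push_cast; ring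
        _ ≤ _ := by
            gcongr
            exact Real.one_le_rpow hn1 (by positivity)
    have f3 : 0 ≤ C * B * ((n : ℝ) ^ (1 / c₁) * l ^ (-(2 * α))) := by positivity
    have f4 := mul_le_mul_of_nonneg_left (add_le_add f1 f2) hC.le
    linarith

lemma poissonRisk_const_mul (S : ℕ) (lam : ℝ) (P : Fin S → ℝ) (c t : ℝ)
    (est : (Fin S → ℕ) → ℝ) :
    poissonRisk S lam P (c * t) (fun z => c * est z) =
      ENNReal.ofReal (c ^ 2) * poissonRisk S lam P t est := by
  rw [poissonRisk, poissonRisk, ← ENNReal.tsum_mul_left]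
  refine tsum_congr fun z => ?_
  rw [← ENNReal.ofReal_mul (sq_nonneg c)]
  congr 1; ring

theorem poissonMinimax_Falpha_le {α c₁ : ℝ} (h0 : 0 < α) (h1 : α ≤ 1 / 2) (hc : 0 < c₁) :
    ∃ C : ℝ, 0 < C ∧ ∀ S n : ℕ, 2 ≤ S → 2 ≤ n → Real.log n ≤ c₁ * Real.log S →
      poissonMinimax S (n : ℝ) (Falpha S α)
        ≤ ENNReal.ofReal (C * ((S : ℝ) ^ 2 / ((n : ℝ) * Real.log n) ^ (2 * α))) := by
  obtain ⟨C, hC, H⟩ := exists_poisson_power_estimator h0 h1 hc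
  refine ⟨C + C ^ 2, by positivity, fun S n hS hn hlog => ?_⟩
  obtain ⟨g, hg⟩ := H n hn
  have hn2 : (2:ℝ) ≤ n := by exact_mod_cast hn
  have hn0 : (0:ℝ) < n := by linarith
  have hS0 : (0:ℝ) < S := by
    have : (2:ℝ) ≤ S := by exact_mod_cast hS
    linarith
  have hl0 : 0 < Real.log n := Real.log_pos (by linarith)
  have hnS : (n : ℝ) ^ (1 / c₁) ≤ S := by
    rw [Real.rpow_def_of_pos hn0, ← Real.exp_log hS0]
    apply Real.exp_le_exp.2
    rw [mul_one_div, div_le_iff₀ hc]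
    linarith
  refine iInf_le_of_le (fun z => (n : ℝ) ^ (-α) * ∑ i, g (z i)) (iSup₂_le fun P hP => ?_)
  have hP1 : ∀ i, P i ≤ 1 := fun i => by
    rw [← hP.2]
    exact Finset.single_le_sum (fun j _ => hP.1 j) (Finset.mem_univ i)
  have hnP : ∀ i, 0 ≤ n * P i := fun i => mul_nonneg hn0.le (hP.1 i)
  have hnP' : ∀ i, n * P i ≤ n := fun i => mul_le_of_le_one_right hn0.le (hP1 i)
  have hF : Falpha S α P = (n : ℝ) ^ (-α) * ∑ i, (n * P i) ^ α := by
    rw [Falpha, Finset.mul_sum]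
    refine Finset.sum_congr rfl fun i _ => ?_
    rw [Real.mul_rpow hn0.le (hP.1 i), ← mul_assoc, ← Real.rpow_add hn0]
    simp
  rw [hF, poissonRisk_const_mul]
  have key := poissonRisk_sum_le (lam := n) (P := P) hnP (fun i => (n * P i) ^ α) g
    (C * Real.log n ^ (-α)) (C * ((n : ℝ) ^ (1 / c₁) * Real.log n ^ (-(2 * α))))
    (fun i => (hg _ (hnP i) (hnP' i)).1) (fun i => (hg _ (hnP i) (hnP' i)).2.1)
    (fun i => (hg _ (hnP i) (hnP' i)).2.2)
  refine (mul_le_mul_right key _).trans ?_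
  rw [← ENNReal.ofReal_mul (sq_nonneg _)]
  refine ENNReal.ofReal_le_ofReal ?_
  have s1 : ∀ x : ℝ, 0 < x → (x ^ (-α)) ^ 2 = x ^ (-(2 * α)) := by
    intro x hx
    rw [← Real.rpow_natCast, ← Real.rpow_mul hx.le]
    congr 1; push_cast; ring
  have s2 : ((n : ℝ) * Real.log n) ^ (2 * α) =
      ((n : ℝ) ^ (-(2 * α)) * Real.log n ^ (-(2 * α)))⁻¹ := by
    rw [← Real.mul_rpow hn0.le hl0.le, Real.rpow_neg (by positivity), inv_inv]
  rw [s2, s1 _ hn0, mul_pow, mul_pow, s1 _ hl0, div_inv_eq_mul]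
  have hb : 0 < Real.log n ^ (-(2 * α)) := Real.rpow_pos_of_pos hl0 _
  have ha : 0 < (n : ℝ) ^ (-(2 * α)) := Real.rpow_pos_of_pos hn0 _
  calc _ ≤ (n : ℝ) ^ (-(2 * α)) * (S * (C * (S * Real.log n ^ (-(2 * α)))) +
        S ^ 2 * (C ^ 2 * Real.log n ^ (-(2 * α)))) := by gcongr
    _ = _ := by ring

/-- The standard primitive root of unity of order `4 * L`. -/
noncomputable def quadRoot (L : ℕ) : ℂ := Complex.exp (2 * Real.pi * Complex.I / (4 * L : ℕ))

/-- The nodes `(1 - cos θ) / 2` for the angles `θ` of the `4 * L`-th roots of unity. -/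
noncomputable def chebNode (L k : ℕ) : ℝ := (1 - (quadRoot L ^ k).re) / 2

/-- The alternating Fejér weight at the node of index `k`. -/
noncomputable def chebWeight (L k : ℕ) : ℝ :=
  (-1) ^ k * (Complex.normSq (∑ a ∈ Finset.range L, (quadRoot L ^ k) ^ a) / (4 * L * L))

section
variable {L : ℕ}

lemma quadRoot_isPrimitiveRoot (hL : 0 < L) : IsPrimitiveRoot (quadRoot L) (4 * L) :=
  Complex.isPrimitiveRoot_exp (4 * L) (by omega)

lemma norm_quadRoot_pow (hL : 0 < L) (k : ℕ) : ‖quadRoot L ^ k‖ = 1 := by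
  rw [norm_pow, (quadRoot_isPrimitiveRoot hL).norm'_eq_one (by omega), one_pow]

lemma quadRoot_pow_ne_zero (hL : 0 < L) (k : ℕ) : quadRoot L ^ k ≠ 0 := by
  rw [← norm_pos_iff, norm_quadRoot_pow hL]; exact one_pos

lemma quadRoot_pow_two_mul (hL : 0 < L) : quadRoot L ^ (2 * L) = -1 := by
  rw [quadRoot, ← Complex.exp_nat_mul, ← Complex.exp_pi_mul_I]
  congr 1
  have : (L : ℂ) ≠ 0 := by exact_mod_cast hL.ne'
  push_cast
  field_simp
  ring

lemma sum_quadRoot_zpow (hL : 0 < L) (j : ℤ) :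
    ∑ k ∈ Finset.range (4 * L), (quadRoot L ^ k) ^ j =
      if ((4 * L : ℕ) : ℤ) ∣ j then ((4 * L : ℕ) : ℂ) else 0 := by
  have hz := quadRoot_isPrimitiveRoot hL
  have e : ∀ k ∈ Finset.range (4 * L), (quadRoot L ^ k) ^ j = (quadRoot L ^ j) ^ k := by
    intro k _
    rw [← zpow_natCast, ← zpow_mul, ← zpow_natCast, ← zpow_mul, mul_comm]
  rw [Finset.sum_congr rfl e]
  split_ifs with h
  · rw [(hz.zpow_eq_one_iff_dvd j).2 h]; simp
  · have h1 : quadRoot L ^ j ≠ 1 := fun h' => h ((hz.zpow_eq_one_iff_dvd j).1 h')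
    rw [geom_sum_eq h1, ← zpow_natCast, ← zpow_mul, mul_comm, zpow_mul, zpow_natCast,
      hz.pow_eq_one]
    simp

lemma normSq_sum_quadRoot (hL : 0 < L) (k : ℕ) :
    (Complex.normSq (∑ a ∈ Finset.range L, (quadRoot L ^ k) ^ a) : ℂ) =
      ∑ a ∈ Finset.range L, ∑ b ∈ Finset.range L, (quadRoot L ^ k) ^ ((a : ℤ) - b) := by
  have hc : (starRingEnd ℂ) (quadRoot L ^ k) = (quadRoot L ^ k)⁻¹ :=
    (Complex.inv_eq_conj (norm_quadRoot_pow hL k)).symm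
  rw [← Complex.mul_conj, map_sum, Finset.sum_mul_sum]
  refine Finset.sum_congr rfl fun a _ => Finset.sum_congr rfl fun b _ => ?_
  rw [map_pow, hc, zpow_sub₀ (quadRoot_pow_ne_zero hL k), zpow_natCast, zpow_natCast, inv_pow,
    div_eq_mul_inv]

lemma sum_chebWeight_mul_zpow (hL : 0 < L) (j : ℤ) :
    ∑ k ∈ Finset.range (4 * L), (chebWeight L k : ℂ) * (quadRoot L ^ k) ^ j =
      (∑ a ∈ Finset.range L, ∑ b ∈ Finset.range L,
        if ((4 * L : ℕ) : ℤ) ∣ 2 * L + (a - b) + j then (1:ℂ) else 0) / L := by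
  have hL' : (L : ℂ) ≠ 0 := by exact_mod_cast hL.ne'
  have e : ∀ k ∈ Finset.range (4 * L), (chebWeight L k : ℂ) * (quadRoot L ^ k) ^ j =
      (∑ a ∈ Finset.range L, ∑ b ∈ Finset.range L,
        (quadRoot L ^ k) ^ (2 * L + ((a : ℤ) - b) + j)) / (4 * L * L) := by
    intro k _
    have h1 : ((-1 : ℂ)) ^ k = (quadRoot L ^ k) ^ (2 * L : ℤ) := by
      rw [← quadRoot_pow_two_mul hL, ← pow_mul, mul_comm, pow_mul, ← zpow_natCast]
      norm_cast
    rw [chebWeight]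
    push_cast
    rw [normSq_sum_quadRoot hL, h1, mul_div_assoc', div_mul_eq_mul_div, Finset.mul_sum,
      Finset.sum_mul]
    congr 1
    refine Finset.sum_congr rfl fun a _ => ?_
    rw [Finset.mul_sum, Finset.sum_mul]
    refine Finset.sum_congr rfl fun b _ => ?_
    rw [zpow_add₀ (quadRoot_pow_ne_zero hL k), zpow_add₀ (quadRoot_pow_ne_zero hL k)]
  rw [Finset.sum_congr rfl e, ← Finset.sum_div, Finset.sum_comm]
  have e2 : ∀ a ∈ Finset.range L, ∑ k ∈ Finset.range (4 * L), ∑ b ∈ Finset.range L,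
      (quadRoot L ^ k) ^ (2 * L + ((a : ℤ) - b) + j) = (4 * L) * ∑ b ∈ Finset.range L,
        if ((4 * L : ℕ) : ℤ) ∣ 2 * L + (a - b) + j then (1:ℂ) else 0 := by
    intro a _
    rw [Finset.sum_comm, Finset.mul_sum]
    refine Finset.sum_congr rfl fun b _ => ?_
    rw [sum_quadRoot_zpow hL]
    split_ifs <;> simp
  rw [Finset.sum_congr rfl e2, ← Finset.mul_sum]
  field_simp

lemma sum_chebWeight_mul_zpow_eq_zero (hL : 0 < L) {j : ℤ} (hj : |j| ≤ L) :
    ∑ k ∈ Finset.range (4 * L), (chebWeight L k : ℂ) * (quadRoot L ^ k) ^ j = 0 := by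
  rw [sum_chebWeight_mul_zpow hL, Finset.sum_eq_zero, zero_div]
  intro a ha
  refine Finset.sum_eq_zero fun b hb => if_neg ?_
  rw [Finset.mem_range] at ha hb
  rw [abs_le] at hj
  intro h
  have := Int.le_of_dvd (by omega) h
  omega

lemma sum_chebWeight_mul_zpow_re_nonneg (hL : 0 < L) (j : ℤ) :
    0 ≤ (∑ k ∈ Finset.range (4 * L), (chebWeight L k : ℂ) * (quadRoot L ^ k) ^ j).re := by
  have : (∑ k ∈ Finset.range (4 * L), (chebWeight L k : ℂ) * (quadRoot L ^ k) ^ j) =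
      (((∑ a ∈ Finset.range L, ∑ b ∈ Finset.range L,
        if ((4 * L : ℕ) : ℤ) ∣ 2 * L + (a - b) + j then (1:ℝ) else 0) / L : ℝ) : ℂ) := by
    rw [sum_chebWeight_mul_zpow hL, Complex.ofReal_div, Complex.ofReal_sum]
    congr 1
    refine Finset.sum_congr rfl fun a _ => ?_
    rw [Complex.ofReal_sum]
    refine Finset.sum_congr rfl fun b _ => ?_
    split_ifs <;> simp
  rw [this, Complex.ofReal_re]
  refine div_nonneg (Finset.sum_nonneg fun a _ => Finset.sum_nonneg fun b _ => ?_)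
    (Nat.cast_nonneg _)
  split_ifs <;> norm_num

lemma abs_chebWeight (k : ℕ) : |chebWeight L k| =
    Complex.normSq (∑ a ∈ Finset.range L, (quadRoot L ^ k) ^ a) / (4 * L * L) := by
  rw [chebWeight, abs_mul, abs_pow, abs_neg, abs_one, one_pow, one_mul]
  exact abs_of_nonneg (div_nonneg (Complex.normSq_nonneg _) (by positivity))

lemma sum_abs_chebWeight (hL : 0 < L) :
    ∑ k ∈ Finset.range (4 * L), |chebWeight L k| = 1 := by
  have hL' : (L : ℂ) ≠ 0 := by exact_mod_cast hL.ne'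
  have : ((∑ k ∈ Finset.range (4 * L), |chebWeight L k| : ℝ) : ℂ) = 1 := by
    simp only [abs_chebWeight]
    push_cast
    simp only [normSq_sum_quadRoot hL]
    rw [← Finset.sum_div, Finset.sum_comm]
    have e2 : ∀ a ∈ Finset.range L, ∑ k ∈ Finset.range (4 * L), ∑ b ∈ Finset.range L,
        (quadRoot L ^ k) ^ ((a : ℤ) - b) = 4 * L := by
      intro a ha
      rw [Finset.sum_comm, Finset.sum_eq_single a]
      · simp
      · intro b hb hba
        rw [sum_quadRoot_zpow hL, if_neg]
        rw [Finset.mem_range] at ha hb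
        intro h
        obtain ⟨c, hc⟩ := h
        have h1 : |(a : ℤ) - b| < 4 * L := by rw [abs_lt]; omega
        have : (a : ℤ) - b = 0 := Int.eq_zero_of_abs_lt_dvd ⟨c, hc⟩ (by push_cast; exact h1)
        omega
      · intro h; exact absurd ha h
    rw [Finset.sum_congr rfl e2]
    simp
    field_simp
  exact_mod_cast this

lemma chebNode_mem (hL : 0 < L) (k : ℕ) : chebNode L k ∈ Set.Icc (0:ℝ) 1 := by
  have := Complex.abs_re_le_norm (quadRoot L ^ k)
  rw [norm_quadRoot_pow hL, abs_le] at this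
  rw [chebNode]
  constructor <;> linarith [this.1, this.2]

lemma ofReal_chebNode (hL : 0 < L) (k : ℕ) : (chebNode L k : ℂ) =
    1 / 2 - (quadRoot L ^ k) ^ (1 : ℤ) / 4 - (quadRoot L ^ k) ^ (-1 : ℤ) / 4 := by
  have hc : (starRingEnd ℂ) (quadRoot L ^ k) = (quadRoot L ^ k)⁻¹ :=
    (Complex.inv_eq_conj (norm_quadRoot_pow hL k)).symm
  rw [chebNode, zpow_neg_one, zpow_one, ← hc]
  push_cast
  rw [Complex.re_eq_add_conj]
  ring

lemma sum_chebWeight_mul_chebNode_pow (hL : 0 < L) {d : ℕ} (hd : d ≤ L) :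
    ∑ k ∈ Finset.range (4 * L), chebWeight L k * chebNode L k ^ d = 0 := by
  have key : ∀ d : ℕ, ∀ j : ℤ, |j| + d ≤ L → ∑ k ∈ Finset.range (4 * L),
      (chebWeight L k : ℂ) * (quadRoot L ^ k) ^ j * (chebNode L k : ℂ) ^ d = 0 := by
    intro d
    induction d with
    | zero =>
      intro j hj
      simpa using sum_chebWeight_mul_zpow_eq_zero hL (j := j) (by simpa using hj)
    | succ d ih =>
      intro j hj
      have h0 := ih j (by push_cast at hj; linarith)
      have h1 := ih (j + 1) (by push_cast at hj; linarith [abs_add_le j 1, abs_one (α := ℤ)])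
      have h2 := ih (j + -1) (by
        push_cast at hj; linarith [abs_add_le j (-1), abs_neg (1:ℤ), abs_one (α := ℤ)])
      have e : ∀ k ∈ Finset.range (4 * L),
          (chebWeight L k : ℂ) * (quadRoot L ^ k) ^ j * (chebNode L k : ℂ) ^ (d + 1) =
          1 / 2 * ((chebWeight L k : ℂ) * (quadRoot L ^ k) ^ j * (chebNode L k : ℂ) ^ d) -
          1 / 4 * ((chebWeight L k : ℂ) * (quadRoot L ^ k) ^ (j + 1) *
            (chebNode L k : ℂ) ^ d) -
          1 / 4 * ((chebWeight L k : ℂ) * (quadRoot L ^ k) ^ (j + -1) *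
            (chebNode L k : ℂ) ^ d) := by
        intro k _
        rw [zpow_add₀ (quadRoot_pow_ne_zero hL k), zpow_add₀ (quadRoot_pow_ne_zero hL k),
          pow_succ]
        nth_rewrite 2 [ofReal_chebNode hL]
        ring
      rw [Finset.sum_congr rfl e, Finset.sum_sub_distrib, Finset.sum_sub_distrib,
        ← Finset.mul_sum, ← Finset.mul_sum, ← Finset.mul_sum, h0, h1, h2]
      simp
  have h := key d 0 (by simpa using hd)
  simp only [zpow_zero, mul_one] at h
  exact_mod_cast h

end

section
variable {L : ℕ}

lemma inv_add_chebNode (hL : 0 < L) {ρ : ℝ} (h0 : 0 < ρ) (h1 : ρ < 1) (k : ℕ) :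
    ((1 - ρ) ^ 2 / (4 * ρ) + chebNode L k)⁻¹ = 4 * ρ / (1 - ρ ^ 2) *
      (2 / (1 - ρ ^ (4 * L)) *
        (∑ j ∈ Finset.range (4 * L), (ρ : ℂ) ^ j * (quadRoot L ^ k) ^ j).re - 1) := by
  set q := quadRoot L ^ k with hq
  have hqn : q.re ^ 2 + q.im ^ 2 = 1 := by
    have := Complex.normSq_eq_norm_sq q
    rw [norm_quadRoot_pow hL, Complex.normSq_apply] at this
    linarith
  have hq1 : q ^ (4 * L) = 1 := by
    rw [hq, ← pow_mul, mul_comm, pow_mul, (quadRoot_isPrimitiveRoot hL).pow_eq_one, one_pow]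
  have hre : q.re ≤ 1 := by nlinarith [sq_nonneg q.im]
  have hD : 0 < 1 - 2 * ρ * q.re + ρ ^ 2 := by nlinarith [mul_le_mul_of_nonneg_left hre h0.le]
  have hR : 0 < 1 - ρ ^ (4 * L) := by
    have := pow_lt_one₀ h0.le h1 (show 4 * L ≠ 0 by omega)
    linarith
  have hρ : 0 < 1 - ρ ^ 2 := by nlinarith
  set G := ∑ j ∈ Finset.range (4 * L), (ρ : ℂ) ^ j * q ^ j with hG
  have hgeom : G * (1 - ρ * q) = ((1 - ρ ^ (4 * L) : ℝ) : ℂ) := by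
    have := geom_sum_mul_neg ((ρ : ℂ) * q) (4 * L)
    rw [mul_pow, hq1, mul_one] at this
    rw [hG]
    simp only [← mul_pow]
    rw [this]
    push_cast
    ring
  have hGD : G.re * (1 - 2 * ρ * q.re + ρ ^ 2) = (1 - ρ ^ (4 * L)) * (1 - ρ * q.re) := by
    have a := congrArg Complex.re hgeom
    have b := congrArg Complex.im hgeom
    simp only [Complex.mul_re, Complex.mul_im, Complex.sub_re, Complex.sub_im, Complex.one_re,
      Complex.one_im, Complex.ofReal_re, Complex.ofReal_im, zero_mul, sub_zero, add_zero] at a b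
    linear_combination (1 - ρ * q.re) * a + (ρ * q.im) * (-b) - G.re * ρ ^ 2 * hqn
  have hG2 : G.re = (1 - ρ ^ (4 * L)) * (1 - ρ * q.re) / (1 - 2 * ρ * q.re + ρ ^ 2) := by
    rw [eq_div_iff hD.ne', hGD]
  have hx : (1 - ρ) ^ 2 / (4 * ρ) + chebNode L k = (1 - 2 * ρ * q.re + ρ ^ 2) / (4 * ρ) := by
    rw [chebNode, ← hq]; field_simp; ring
  rw [hx, hG2, inv_div]
  generalize hDe : 1 - 2 * ρ * q.re + ρ ^ 2 = D at hD ⊢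
  have hDe' : 2 * (1 - ρ * q.re) = D + (1 - ρ ^ 2) := by rw [← hDe]; ring
  have : 2 / (1 - ρ ^ (4 * L)) * ((1 - ρ ^ (4 * L)) * (1 - ρ * q.re) / D) =
      2 * (1 - ρ * q.re) / D := by field_simp
  rw [this, hDe']
  field_simp
  ring

lemma sum_chebWeight_mul_inv (hL : 0 < L) {ρ : ℝ} (h0 : 0 < ρ) (h1 : ρ < 1) :
    ∑ k ∈ Finset.range (4 * L), chebWeight L k * ((1 - ρ) ^ 2 / (4 * ρ) + chebNode L k)⁻¹ =
      8 * ρ / ((1 - ρ ^ 2) * (1 - ρ ^ (4 * L))) * ∑ j ∈ Finset.range (4 * L), ρ ^ j *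
        (∑ k ∈ Finset.range (4 * L), (chebWeight L k : ℂ) * (quadRoot L ^ k) ^ (j : ℤ)).re := by
  have hw : ∑ k ∈ Finset.range (4 * L), chebWeight L k = 0 := by
    simpa using sum_chebWeight_mul_chebNode_pow hL (Nat.zero_le L)
  have hR : 0 < 1 - ρ ^ (4 * L) := by
    have := pow_lt_one₀ h0.le h1 (show 4 * L ≠ 0 by omega)
    linarith
  have hρ : 0 < 1 - ρ ^ 2 := by nlinarith
  have e : ∀ k ∈ Finset.range (4 * L),
      chebWeight L k * ((1 - ρ) ^ 2 / (4 * ρ) + chebNode L k)⁻¹ =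
      8 * ρ / ((1 - ρ ^ 2) * (1 - ρ ^ (4 * L))) * (∑ j ∈ Finset.range (4 * L),
        ρ ^ j * ((chebWeight L k : ℂ) * (quadRoot L ^ k) ^ (j : ℤ)).re) -
      4 * ρ / (1 - ρ ^ 2) * chebWeight L k := by
    intro k _
    rw [inv_add_chebNode hL h0 h1, Complex.re_sum]
    have : ∀ j ∈ Finset.range (4 * L),
        ρ ^ j * ((chebWeight L k : ℂ) * (quadRoot L ^ k) ^ (j : ℤ)).re =
        chebWeight L k * ((ρ : ℂ) ^ j * (quadRoot L ^ k) ^ j).re := by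
      intro j _
      rw [Complex.re_ofReal_mul, ← Complex.ofReal_pow, Complex.re_ofReal_mul, zpow_natCast]
      ring
    rw [Finset.sum_congr rfl this, ← Finset.mul_sum]
    field_simp
    ring
  rw [Finset.sum_congr rfl e, Finset.sum_sub_distrib, ← Finset.mul_sum, ← Finset.mul_sum, hw,
    mul_zero, sub_zero, Finset.sum_comm]
  simp only [Complex.re_sum, Finset.mul_sum]

lemma sum_re_sum_chebWeight_mul_zpow (hL : 0 < L) :
    ∑ j ∈ Finset.range (4 * L),
      (∑ k ∈ Finset.range (4 * L), (chebWeight L k : ℂ) * (quadRoot L ^ k) ^ (j : ℤ)).re = L := by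
  have hL' : (L : ℝ) ≠ 0 := by exact_mod_cast hL.ne'
  rw [← Complex.re_sum, Finset.sum_comm, Finset.sum_eq_single 0]
  · have h0 : chebWeight L 0 = 1 / 4 := by
      simp [chebWeight, Complex.normSq_natCast]
      field_simp
    rw [h0]
    simp only [pow_zero, one_zpow, mul_one, Finset.sum_const, Finset.card_range, nsmul_eq_mul]
    rw [← Complex.ofReal_natCast, ← Complex.ofReal_mul, Complex.ofReal_re]
    push_cast
    ring
  · intro k hk hk0
    rw [Finset.mem_range] at hk
    rw [← Finset.mul_sum]
    have e : ∀ j ∈ Finset.range (4 * L), (quadRoot L ^ k) ^ (j : ℤ) =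
        (quadRoot L ^ j) ^ (k : ℤ) := by
      intro j _
      rw [zpow_natCast, zpow_natCast, ← pow_mul, ← pow_mul, mul_comm]
    rw [Finset.sum_congr rfl e, sum_quadRoot_zpow hL, if_neg, mul_zero]
    intro h
    have := Nat.le_of_dvd (by omega) (Int.natCast_dvd_natCast.1 h)
    omega
  · intro h
    exact absurd (Finset.mem_range.2 (by omega)) h

lemma sq_one_sub_div_eq {s : ℝ} (hs : 0 < s) : ∃ ρ : ℝ, 0 < ρ ∧ ρ < 1 ∧
    (1 - ρ) ^ 2 / (4 * ρ) = s ∧ (1 - √s) ≤ √ρ := by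
  have h1 : √(1 + s) ^ 2 = 1 + s := Real.sq_sqrt (by linarith)
  have h2 : √s ^ 2 = s := Real.sq_sqrt hs.le
  have h3 : 0 < √s := Real.sqrt_pos.2 hs
  have h4 : 1 < √(1 + s) := by
    rw [Real.lt_sqrt zero_le_one]; linarith
  have h5 : √s < √(1 + s) := Real.sqrt_lt_sqrt hs.le (by linarith)
  have h6 : (√(1 + s) - √s) * (√(1 + s) + √s) = 1 := by ring_nf; linarith
  have h7 : √(1 + s) - √s < 1 := by nlinarith
  refine ⟨(√(1 + s) - √s) ^ 2, by nlinarith, by nlinarith, ?_, ?_⟩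
  · rw [div_eq_iff (by have := sub_pos.2 h5; positivity)]
    have : 1 - (√(1 + s) - √s) ^ 2 = (√(1 + s) - √s) * (2 * √s) := by
      linear_combination (-1) * h6
    rw [this, mul_pow, mul_pow, h2]
    ring
  · rw [Real.sqrt_sq (by linarith)]
    linarith

lemma sum_chebWeight_mul_inv_nonneg (hL : 0 < L) {s : ℝ} (hs : 0 < s) :
    0 ≤ ∑ k ∈ Finset.range (4 * L), chebWeight L k * (s + chebNode L k)⁻¹ := by
  obtain ⟨ρ, h0, h1, rfl, -⟩ := sq_one_sub_div_eq hs
  rw [sum_chebWeight_mul_inv hL h0 h1]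
  have hR : 0 ≤ 1 - ρ ^ (4 * L) := by linarith [pow_le_one₀ (n := 4 * L) h0.le h1.le]
  have hρ : 0 ≤ 1 - ρ ^ 2 := by nlinarith
  refine mul_nonneg (by positivity) (Finset.sum_nonneg fun j _ => ?_)
  exact mul_nonneg (by positivity) (sum_chebWeight_mul_zpow_re_nonneg hL j)

lemma le_sum_chebWeight_mul_inv (hL : 0 < L) {s : ℝ} (hs : 0 < s) (hsL : √s ≤ 1 / (4 * L)) :
    2 * Real.exp (-5) * L / √s ≤
      ∑ k ∈ Finset.range (4 * L), chebWeight L k * (s + chebNode L k)⁻¹ := by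
  have hL1 : (1:ℝ) ≤ L := by exact_mod_cast hL
  obtain ⟨ρ, h0, h1, hρs, hsρ⟩ := sq_one_sub_div_eq hs
  have hs0 : 0 < √s := Real.sqrt_pos.2 hs
  have hs4 : √s ≤ 1 / 4 := hsL.trans (by
    rw [div_le_div_iff₀ (by positivity) (by norm_num)]; linarith)
  have hr2 : √ρ ^ 2 = ρ := Real.sq_sqrt h0.le
  have hR0 : 0 < 1 - ρ ^ (4 * L) := by
    have := pow_lt_one₀ h0.le h1 (show 4 * L ≠ 0 by omega)
    linarith
  have hR1 : 1 - ρ ^ (4 * L) ≤ 1 := by linarith [pow_pos h0 (4 * L)]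
  have hρ : 0 < 1 - ρ ^ 2 := by nlinarith
  have hρ4 : 1 - ρ ^ 2 ≤ 4 * √s := by nlinarith [Real.sqrt_nonneg ρ]
  have hlow : ρ ^ (4 * L) * L ≤ ∑ j ∈ Finset.range (4 * L), ρ ^ j *
      (∑ k ∈ Finset.range (4 * L), (chebWeight L k : ℂ) * (quadRoot L ^ k) ^ (j : ℤ)).re := by
    rw [← sum_re_sum_chebWeight_mul_zpow hL, Finset.mul_sum]
    refine Finset.sum_le_sum fun j hj => ?_
    refine mul_le_mul_of_nonneg_right ?_ (sum_chebWeight_mul_zpow_re_nonneg hL j)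
    exact pow_le_pow_of_le_one h0.le h1.le (Finset.mem_range.1 hj).le
  have hexp : Real.exp (-5) ≤ ρ * ρ ^ (4 * L) := by
    have a1 : Real.exp (-(2 * √s)) ≤ √ρ := by
      refine le_trans ?_ hsρ
      rw [Real.exp_neg]
      have := Real.add_one_le_exp (2 * √s)
      calc (Real.exp (2 * √s))⁻¹ ≤ (2 * √s + 1)⁻¹ :=
            inv_anti₀ (by positivity) this
        _ ≤ 1 - √s := by
            rw [inv_le_iff_one_le_mul₀ (by positivity)]; nlinarith
    have a2 : Real.exp (-(4 * √s)) ≤ ρ := by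
      rw [← hr2]
      calc _ = Real.exp (-(2 * √s)) ^ 2 := by
            rw [← Real.exp_nat_mul]; congr 1; push_cast; ring
        _ ≤ _ := pow_le_pow_left₀ (Real.exp_pos _).le a1 2
    calc Real.exp (-5) ≤ Real.exp (-(4 * √s)) ^ (4 * L + 1) := by
          rw [← Real.exp_nat_mul]
          apply Real.exp_le_exp.2
          rw [le_div_iff₀ (by positivity)] at hsL
          push_cast
          nlinarith
      _ ≤ ρ ^ (4 * L + 1) := pow_le_pow_left₀ (Real.exp_pos _).le a2 _
      _ = _ := pow_succ' _ _
  nth_rewrite 2 [← hρs]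
  rw [sum_chebWeight_mul_inv hL h0 h1]
  calc 2 * Real.exp (-5) * L / √s = 8 / (4 * √s * 1) * (Real.exp (-5) * L) := by
        field_simp; norm_num
    _ ≤ 8 / ((1 - ρ ^ 2) * (1 - ρ ^ (4 * L))) * ((ρ * ρ ^ (4 * L)) * L) := by gcongr
    _ = 8 * ρ / ((1 - ρ ^ 2) * (1 - ρ ^ (4 * L))) * (ρ ^ (4 * L) * L) := by ring
    _ ≤ _ := by gcongr
end

lemma le_neg_sum_chebWeight_mul_rpow {α : ℝ} (h0 : 0 < α) (h1 : α ≤ 1 / 2) {L : ℕ}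
    (hL : 0 < L) :
    Real.exp (-5) / 2 * (4 * L : ℝ) ^ (-(2 * α)) ≤
      (∫ t in Set.Ioi (0:ℝ), Real.rpowIntegrand₀₁ α t 1) *
        -∑ k ∈ Finset.range (4 * L), chebWeight L k * chebNode L k ^ α := by
  have hp : α ∈ Set.Ioo (0:ℝ) 1 := ⟨h0, by linarith⟩
  have hL0 : (0:ℝ) < L := by exact_mod_cast hL
  have hw : ∑ k ∈ Finset.range (4 * L), chebWeight L k = 0 := by
    simpa using sum_chebWeight_mul_chebNode_pow hL (Nat.zero_le L)
  set R : ℝ → ℝ := fun t => ∑ k ∈ Finset.range (4 * L), chebWeight L k * (t + chebNode L k)⁻¹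
    with hR
  have hsum : ∀ t : ℝ, -∑ k ∈ Finset.range (4 * L),
      chebWeight L k * Real.rpowIntegrand₀₁ α t (chebNode L k) = t ^ α * R t := by
    intro t
    have : ∀ k ∈ Finset.range (4 * L),
        chebWeight L k * Real.rpowIntegrand₀₁ α t (chebNode L k) =
        t ^ α * t⁻¹ * chebWeight L k -
          t ^ α * (chebWeight L k * (t + chebNode L k)⁻¹) := by
      intro k _
      rw [Real.rpowIntegrand₀₁]; ring
    rw [Finset.sum_congr rfl this, Finset.sum_sub_distrib, ← Finset.mul_sum, ← Finset.mul_sum, hw,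
      hR]
    ring
  have h_int : ∀ k ∈ Finset.range (4 * L), IntegrableOn
      (fun t => chebWeight L k * Real.rpowIntegrand₀₁ α t (chebNode L k)) (Set.Ioi 0) :=
    fun k _ => (Real.integrableOn_rpowIntegrand₀₁_Ioi hp (chebNode_mem hL k).1).const_mul _
  have hRint : IntegrableOn (fun t => t ^ α * R t) (Set.Ioi 0) := by
    have := (integrable_finsetSum _ h_int).neg
    refine this.congr (ae_of_all _ fun t => ?_)
    simp only [← hsum, Pi.neg_apply]
  have hEq : (∫ t in Set.Ioi (0:ℝ), Real.rpowIntegrand₀₁ α t 1) *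
        -∑ k ∈ Finset.range (4 * L), chebWeight L k * chebNode L k ^ α =
      ∫ t in Set.Ioi (0:ℝ), t ^ α * R t := by
    simp_rw [← hsum]
    rw [integral_neg, integral_finsetSum _ h_int, mul_neg, Finset.mul_sum]
    congr 1
    refine Finset.sum_congr rfl fun k _ => ?_
    rw [integral_const_mul,
      Real.integral_rpowIntegrand₀₁_eq_rpow_mul_const hp (chebNode_mem hL k).1]
    ring
  rw [hEq]
  set b : ℝ := (1 / (4 * L)) ^ 2 with hb
  have hb0 : 0 < b := by positivity
  have hsb : √b = 1 / (4 * L) := by rw [hb, Real.sqrt_sq (by positivity)]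
  calc Real.exp (-5) / 2 * (4 * L : ℝ) ^ (-(2 * α))
      = ∫ t in Set.Ioc 0 b, 2 * Real.exp (-5) * L * b ^ (α - 1 / 2) := by
        have e1 : b ^ (α - 1 / 2) * b = (4 * L : ℝ) ^ (-(2 * α)) * (1 / (4 * L)) := by
          have : b = (4 * L : ℝ) ^ (-2 : ℝ) := by
            rw [hb, Real.rpow_neg (by positivity), Real.rpow_two, one_div, inv_pow]
          nth_rewrite 2 [← Real.rpow_one b]
          rw [← Real.rpow_add hb0, this, ← Real.rpow_mul (by positivity), one_div (4 * L : ℝ),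
            ← Real.rpow_neg_one (4 * L : ℝ), ← Real.rpow_add (by positivity)]
          congr 1; ring
        rw [setIntegral_const, smul_eq_mul, Real.volume_real_Ioc_of_le hb0.le, sub_zero]
        calc _ = 2 * Real.exp (-5) * L * ((4 * L : ℝ) ^ (-(2 * α)) * (1 / (4 * L))) := by
              field_simp; norm_num
          _ = _ := by rw [← e1]; ring
    _ ≤ ∫ t in Set.Ioc 0 b, t ^ α * R t := by
        refine setIntegral_mono_on (integrableOn_const (by simp)) (hRint.mono_set fun t ht => ht.1)
          measurableSet_Ioc fun t ht => ?_
        have hst : √t ≤ 1 / (4 * L) := by rw [← hsb]; exact Real.sqrt_le_sqrt ht.2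
        have := mul_le_mul_of_nonneg_left (le_sum_chebWeight_mul_inv hL ht.1 hst)
          (Real.rpow_nonneg ht.1.le α)
        refine le_trans ?_ this
        have e2 : t ^ α = t ^ (α - 1 / 2) * √t := by
          rw [Real.sqrt_eq_rpow, ← Real.rpow_add ht.1]; congr 1; ring
        have e3 : b ^ (α - 1 / 2) ≤ t ^ (α - 1 / 2) :=
          Real.rpow_le_rpow_of_nonpos ht.1 ht.2 (by linarith)
        have hst0 : √t ≠ 0 := (Real.sqrt_pos.2 ht.1).ne'
        calc _ ≤ 2 * Real.exp (-5) * L * t ^ (α - 1 / 2) := by gcongr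
          _ = _ := by rw [e2]; field_simp
    _ ≤ _ := by
        refine setIntegral_mono_set hRint ?_ (Filter.Eventually.of_forall fun t ht => ht.1)
        refine (ae_restrict_iff' measurableSet_Ioi).2 (ae_of_all _ fun t ht => ?_)
        exact mul_nonneg (Real.rpow_nonneg (le_of_lt ht) _) (sum_chebWeight_mul_inv_nonneg hL ht)

lemma exists_moment_matching {α : ℝ} (h0 : 0 < α) (h1 : α ≤ 1 / 2) :
    ∃ c : ℝ, 0 < c ∧ ∀ L : ℕ, 0 < L → ∃ x u v : Fin (4 * L) → ℝ,
      (∀ k, 0 ≤ x k ∧ x k ≤ 1) ∧ (∀ k, 0 ≤ u k) ∧ (∀ k, 0 ≤ v k) ∧ ∑ k, u k = 1 ∧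
      ∑ k, v k = 1 ∧ (∀ d ≤ L, ∑ k, (u k - v k) * x k ^ d = 0) ∧
      c * (L : ℝ) ^ (-(2 * α)) ≤ ∑ k, (u k - v k) * x k ^ α := by
  have hJ : 0 < ∫ t in Set.Ioi (0:ℝ), Real.rpowIntegrand₀₁ α t 1 :=
    Real.integral_rpowIntegrand₀₁_one_pos ⟨h0, by linarith⟩
  set J := ∫ t in Set.Ioi (0:ℝ), Real.rpowIntegrand₀₁ α t 1 with hJd
  refine ⟨Real.exp (-5) * 4 ^ (-(2 * α)) / J, by positivity, fun L hL => ?_⟩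
  have hw : ∑ k ∈ Finset.range (4 * L), chebWeight L k = 0 := by
    simpa using sum_chebWeight_mul_chebNode_pow hL (Nat.zero_le L)
  refine ⟨fun k => chebNode L k, fun k => |chebWeight L k| - chebWeight L k,
    fun k => |chebWeight L k| + chebWeight L k, fun k => chebNode_mem hL k,
    fun k => sub_nonneg.2 (le_abs_self _), fun k => by linarith [neg_abs_le (chebWeight L k)],
    ?_, ?_, fun d hd => ?_, ?_⟩
  · rw [Finset.sum_sub_distrib, ← Finset.sum_range (fun k => |chebWeight L k|),
      ← Finset.sum_range (fun k => chebWeight L k), hw, sum_abs_chebWeight hL, sub_zero]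
  · rw [Finset.sum_add_distrib, ← Finset.sum_range (fun k => |chebWeight L k|),
      ← Finset.sum_range (fun k => chebWeight L k), hw, sum_abs_chebWeight hL, add_zero]
  · have e : ∀ k : Fin (4 * L), (|chebWeight L k| - chebWeight L k -
        (|chebWeight L k| + chebWeight L k)) * chebNode L k ^ d =
        -2 * (chebWeight L k * chebNode L k ^ d) := fun k => by ring
    simp only [e]
    rw [← Finset.mul_sum, ← Finset.sum_range (fun k => chebWeight L k * chebNode L k ^ d),
      sum_chebWeight_mul_chebNode_pow hL hd, mul_zero]
  · have e : ∀ k : Fin (4 * L), (|chebWeight L k| - chebWeight L k -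
        (|chebWeight L k| + chebWeight L k)) * chebNode L k ^ α =
        -2 * (chebWeight L k * chebNode L k ^ α) := fun k => by ring
    simp only [e]
    rw [← Finset.mul_sum, ← Finset.sum_range (fun k => chebWeight L k * chebNode L k ^ α)]
    have h := le_neg_sum_chebWeight_mul_rpow h0 h1 hL
    rw [← hJd, Real.mul_rpow (by norm_num) (Nat.cast_nonneg _)] at h
    rw [div_mul_eq_mul_div, div_le_iff₀ hJ]
    linarith

section
variable {ι : Type*} [Fintype ι]

lemma sum_mul_pow_mul_sub_pow_eq_zero {W lam : ι → ℝ} {L : ℕ}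
    (hW : ∀ d ≤ L, ∑ a, W a * lam a ^ d = 0) (M : ℝ) {z b : ℕ} (h : z + b ≤ L) :
    ∑ a, W a * (lam a ^ z * (M - lam a) ^ b) = 0 := by
  have e : ∀ a, W a * (lam a ^ z * (M - lam a) ^ b) = ∑ c ∈ Finset.range (b + 1),
      ((-1) ^ c * M ^ (b - c) * (b.choose c)) * (W a * lam a ^ (z + c)) := by
    intro a
    rw [show M - lam a = -lam a + M by ring, add_pow, Finset.mul_sum, Finset.mul_sum]
    refine Finset.sum_congr rfl fun c _ => ?_
    rw [neg_pow, pow_add]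
    ring
  simp only [e]
  rw [Finset.sum_comm]
  refine Finset.sum_eq_zero fun c hc => ?_
  rw [← Finset.mul_sum, hW _ (by have := Finset.mem_range.1 hc; omega), mul_zero]

lemma abs_sum_mul_pow_mul_sub_pow_le {W lam : ι → ℝ} {L : ℕ} {M A K : ℝ}
    (hW : ∀ d ≤ L, ∑ a, W a * lam a ^ d = 0) (hW1 : ∑ a, |W a| ≤ 2)
    (hlam : ∀ a, 0 ≤ lam a ∧ lam a ≤ M) (hM : 0 ≤ M) (hA : M ≤ A) (hK : 1 ≤ K) (z y : ℕ) :
    |∑ a, W a * (lam a ^ z * (A - lam a) ^ y)| ≤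
      2 / K ^ L * ((K * M) ^ z * (A - M + K * M) ^ y) := by
  have hK0 : 0 < K := by linarith
  have key : ∀ b, |∑ a, W a * (lam a ^ z * (M - lam a) ^ b)| ≤
      2 / K ^ L * (K * M) ^ (z + b) := by
    intro b
    rcases le_or_gt (z + b) L with h | h
    · rw [sum_mul_pow_mul_sub_pow_eq_zero hW M h, abs_zero]
      positivity
    · have h1 : |∑ a, W a * (lam a ^ z * (M - lam a) ^ b)| ≤ 2 * M ^ (z + b) := by
        calc _ ≤ ∑ a, |W a| * M ^ (z + b) := by
              refine (Finset.abs_sum_le_sum_abs _ _).trans (Finset.sum_le_sum fun a _ => ?_)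
              rw [abs_mul]
              refine mul_le_mul_of_nonneg_left ?_ (abs_nonneg _)
              rw [abs_of_nonneg (mul_nonneg (pow_nonneg (hlam a).1 _)
                (pow_nonneg (by linarith [(hlam a).2]) _)), pow_add]
              exact mul_le_mul (pow_le_pow_left₀ (hlam a).1 (hlam a).2 _)
                (pow_le_pow_left₀ (by linarith [(hlam a).2]) (by linarith [(hlam a).1]) _)
                (pow_nonneg (by linarith [(hlam a).2]) _) (pow_nonneg hM _)
          _ ≤ _ := by
              rw [← Finset.sum_mul]
              exact mul_le_mul_of_nonneg_right hW1 (pow_nonneg hM _)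
      refine h1.trans ?_
      rw [mul_pow, div_mul_eq_mul_div, le_div_iff₀ (by positivity)]
      have : K ^ L ≤ K ^ (z + b) := pow_le_pow_right₀ hK h.le
      have := mul_le_mul_of_nonneg_left this (show 0 ≤ 2 * M ^ (z + b) by positivity)
      linarith
  have e : ∀ a, W a * (lam a ^ z * (A - lam a) ^ y) = ∑ b ∈ Finset.range (y + 1),
      ((A - M) ^ (y - b) * y.choose b) * (W a * (lam a ^ z * (M - lam a) ^ b)) := by
    intro a
    rw [show A - lam a = (M - lam a) + (A - M) by ring, add_pow, Finset.mul_sum, Finset.mul_sum]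
    refine Finset.sum_congr rfl fun c _ => ?_
    ring
  simp only [e]
  rw [Finset.sum_comm]
  simp only [← Finset.mul_sum]
  calc _ ≤ ∑ b ∈ Finset.range (y + 1), ((A - M) ^ (y - b) * y.choose b) *
        (2 / K ^ L * (K * M) ^ (z + b)) := by
        refine (Finset.abs_sum_le_sum_abs _ _).trans (Finset.sum_le_sum fun b _ => ?_)
        have : 0 ≤ (A - M) ^ (y - b) * (y.choose b : ℝ) :=
          mul_nonneg (pow_nonneg (by linarith) _) (Nat.cast_nonneg _)
        rw [abs_mul, abs_of_nonneg this]
        exact mul_le_mul_of_nonneg_left (key b) this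
    _ = _ := by
        rw [add_comm (A - M), add_pow, Finset.mul_sum, Finset.mul_sum]
        refine Finset.sum_congr rfl fun b _ => ?_
        rw [pow_add]
        ring

/-- Expectation of `Ψ` under independent coordinates with common weights `u`. -/
def productMean {m : ℕ} (u : ι → ℝ) (Ψ : (Fin m → ι) → ℝ) : ℝ :=
  ∑ k, (∏ j, u (k j)) * Ψ k

lemma productMean_succ {m : ℕ} (u : ι → ℝ) (Ψ : (Fin (m + 1) → ι) → ℝ) :
    productMean u Ψ = ∑ a, u a * productMean u fun k => Ψ (Fin.cons a k) := by
  simp only [productMean]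
  rw [← (Fin.consEquiv fun _ => ι).sum_comp, Fintype.sum_prod_type]
  refine Finset.sum_congr rfl fun a _ => ?_
  rw [Finset.mul_sum]
  refine Finset.sum_congr rfl fun k _ => ?_
  simp [Fin.consEquiv, Fin.prod_univ_succ, mul_assoc]

lemma productMean_add {m : ℕ} (u : ι → ℝ) (Ψ Φ : (Fin m → ι) → ℝ) :
    productMean u (fun k => Ψ k + Φ k) = productMean u Ψ + productMean u Φ := by
  simp [productMean, mul_add, Finset.sum_add_distrib]

lemma productMean_const_mul {m : ℕ} (u : ι → ℝ) (c : ℝ) (Ψ : (Fin m → ι) → ℝ) :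
    productMean u (fun k => c * Ψ k) = c * productMean u Ψ := by
  simp only [productMean, Finset.mul_sum]
  exact Finset.sum_congr rfl fun k _ => by ring

lemma productMean_sum {m : ℕ} (u : ι → ℝ) (Ψ : ι → (Fin m → ι) → ℝ) :
    productMean u (fun k => ∑ a, Ψ a k) = ∑ a, productMean u (Ψ a) := by
  simp only [productMean, Finset.mul_sum]
  exact Finset.sum_comm

lemma productMean_mono {m : ℕ} {u : ι → ℝ} (hu : ∀ a, 0 ≤ u a) {Ψ Φ : (Fin m → ι) → ℝ}
    (h : ∀ k, Ψ k ≤ Φ k) : productMean u Ψ ≤ productMean u Φ :=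
  Finset.sum_le_sum fun k _ =>
    mul_le_mul_of_nonneg_left (h k) (Finset.prod_nonneg fun _ _ => hu _)

lemma productMean_const {u : ι → ℝ} (hu : ∑ a, u a = 1) (c : ℝ) (m : ℕ) :
    productMean u (fun _ : Fin m → ι => c) = c := by
  induction m with
  | zero => simp [productMean]
  | succ m ih => rw [productMean_succ]; simp only [ih]; rw [← Finset.sum_mul, hu, one_mul]

lemma abs_productMean_sub_le {u v : ι → ℝ} (hu : ∀ a, 0 ≤ u a) (hv : ∀ a, 0 ≤ v a)
    (hu1 : ∑ a, u a = 1) (hv1 : ∑ a, v a = 1) {δ : ℝ} {m : ℕ} (Ψ : (Fin m → ι) → ℝ)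
    (h : ∀ i k, |∑ a, (u a - v a) * Ψ (Function.update k i a)| ≤ δ) :
    |productMean u Ψ - productMean v Ψ| ≤ m * δ := by
  induction m with
  | zero => simp [productMean]
  | succ m ih =>
    have e : productMean u Ψ - productMean v Ψ =
        (∑ a, u a * (productMean u (fun k => Ψ (Fin.cons a k)) -
          productMean v (fun k => Ψ (Fin.cons a k)))) +
        productMean v (fun k => ∑ a, (u a - v a) * Ψ (Fin.cons a k)) := by
      rw [productMean_succ, productMean_succ, productMean_sum, ← Finset.sum_add_distrib,
        ← Finset.sum_sub_distrib]
      refine Finset.sum_congr rfl fun a _ => ?_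
      rw [productMean_const_mul]
      ring
    have b1 : |∑ a, u a * (productMean u (fun k => Ψ (Fin.cons a k)) -
          productMean v (fun k => Ψ (Fin.cons a k)))| ≤ m * δ := by
      calc _ ≤ ∑ a, u a * (m * δ) := by
            refine (Finset.abs_sum_le_sum_abs _ _).trans (Finset.sum_le_sum fun a _ => ?_)
            rw [abs_mul, abs_of_nonneg (hu a)]
            refine mul_le_mul_of_nonneg_left (ih _ fun i k => ?_) (hu a)
            have := h i.succ (Fin.cons a k)
            simpa only [Fin.cons_update] using this
        _ = _ := by rw [← Finset.sum_mul, hu1, one_mul]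
    have b3 : ∀ k : Fin m → ι, |∑ a, (u a - v a) * Ψ (Fin.cons a k)| ≤ δ := by
      intro k
      by_cases hι : Nonempty ι
      · obtain ⟨a₀⟩ := hι
        have := h 0 (Fin.cons a₀ k)
        simpa only [Fin.update_cons_zero] using this
      · exfalso
        rw [not_nonempty_iff] at hι
        simp at hu1
    have b2 : |productMean v (fun k => ∑ a, (u a - v a) * Ψ (Fin.cons a k))| ≤ δ := by
      rw [abs_le]
      constructor
      · rw [← productMean_const hv1 (-δ) m]
        exact productMean_mono hv fun k => (abs_le.1 (b3 k)).1
      · calc _ ≤ productMean v (fun _ : Fin m → ι => δ) :=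
            productMean_mono hv fun k => (abs_le.1 (b3 k)).2
          _ = δ := productMean_const hv1 δ m
    rw [e]
    refine (abs_add_le _ _).trans ((add_le_add b1 b2).trans (le_of_eq ?_))
    push_cast
    ring

lemma productMean_sum_eq_zero {u f : ι → ℝ} (hu : ∑ a, u a = 1) (hf : ∑ a, u a * f a = 0)
    (m : ℕ) : productMean u (fun k : Fin m → ι => ∑ j, f (k j)) = 0 := by
  induction m with
  | zero => simp [productMean]
  | succ m ih =>
    rw [productMean_succ]
    simp only [Fin.sum_univ_succ, Fin.cons_zero, Fin.cons_succ]
    simp only [productMean_add, ih, productMean_const hu, add_zero, hf]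

lemma productMean_sum_sq {u f : ι → ℝ} (hu : ∑ a, u a = 1) (hf : ∑ a, u a * f a = 0)
    (m : ℕ) : productMean u (fun k : Fin m → ι => (∑ j, f (k j)) ^ 2) =
      m * ∑ a, u a * f a ^ 2 := by
  induction m with
  | zero => simp [productMean]
  | succ m ih =>
    rw [productMean_succ]
    have e : ∀ a, productMean u (fun k : Fin m → ι =>
        (∑ j, f ((Fin.cons a k : Fin (m + 1) → ι) j)) ^ 2) =
        f a ^ 2 + m * ∑ a, u a * f a ^ 2 := by
      intro a
      have : (fun k : Fin m → ι => (∑ j, f ((Fin.cons a k : Fin (m + 1) → ι) j)) ^ 2) =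
          fun k => (f a ^ 2 + (2 * f a) * ∑ j, f (k j)) + (∑ j, f (k j)) ^ 2 := by
        funext k
        simp only [Fin.sum_univ_succ, Fin.cons_zero, Fin.cons_succ]
        ring
      rw [this, productMean_add, productMean_add, productMean_const hu, productMean_const_mul,
        productMean_sum_eq_zero hu hf, ih]
      ring
    simp only [e, mul_add]
    rw [Finset.sum_add_distrib, ← Finset.sum_mul, hu]
    push_cast
    ring

lemma productMean_deviation_le {u y : ι → ℝ} (hu0 : ∀ a, 0 ≤ u a) (hu : ∑ a, u a = 1)
    (hy : ∀ a, 0 ≤ y a ∧ y a ≤ 1) {t : ℝ} (ht : 0 < t) (m : ℕ) :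
    productMean u (fun k : Fin m → ι =>
      if t ≤ |∑ j, y (k j) - m * ∑ a, u a * y a| then (1:ℝ) else 0) ≤ m / t ^ 2 := by
  set E := ∑ a, u a * y a with hE
  have hE0 : 0 ≤ E := Finset.sum_nonneg fun a _ => mul_nonneg (hu0 a) (hy a).1
  have hE1 : E ≤ 1 := by
    rw [← hu]
    exact Finset.sum_le_sum fun a _ => mul_le_of_le_one_right (hu0 a) (hy a).2
  have hf : ∑ a, u a * (y a - E) = 0 := by
    simp only [mul_sub, Finset.sum_sub_distrib]
    rw [← Finset.sum_mul, hu, ← hE]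
    ring
  have hv : ∑ a, u a * (y a - E) ^ 2 ≤ 1 := by
    rw [← hu]
    refine Finset.sum_le_sum fun a _ => mul_le_of_le_one_right (hu0 a) ?_
    rw [sq_le_one_iff_abs_le_one, abs_le]
    constructor <;> linarith [(hy a).1, (hy a).2]
  rw [le_div_iff₀ (by positivity), mul_comm, ← productMean_const_mul]
  calc _ ≤ productMean u (fun k : Fin m → ι => (∑ j, (y (k j) - E)) ^ 2) := by
        refine productMean_mono hu0 fun k => ?_
        have : ∑ j, (y (k j) - E) = ∑ j, y (k j) - m * E := by
          simp [Finset.sum_sub_distrib]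
        rw [this]
        split_ifs with h
        · rw [mul_one, ← sq_abs (∑ j, y (k j) - m * E)]
          exact pow_le_pow_left₀ ht.le h 2
        · rw [mul_zero]; positivity
    _ = m * ∑ a, u a * (y a - E) ^ 2 := productMean_sum_sq hu hf m
    _ ≤ m := mul_le_of_le_one_right (Nat.cast_nonneg _) hv

end

lemma poissonPMF_one_eq {S : ℕ} (μ : Fin S → ℝ) (z : Fin S → ℕ) :
    poissonPMF S 1 μ z =
      Real.exp (-∑ i, μ i) * ((∏ i, μ i ^ z i) / ∏ i, (Nat.factorial (z i) : ℝ)) := by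
  simp only [poissonPMF, one_mul, Finset.prod_div_distrib, Finset.prod_mul_distrib,
    ← Real.exp_sum, Finset.sum_neg_distrib, mul_div_assoc]

lemma poissonPMF_scale {S : ℕ} (lam : ℝ) (P : Fin S → ℝ) (z : Fin S → ℕ) :
    poissonPMF S lam P z = poissonPMF S 1 (fun i => lam * P i) z := by
  simp [poissonPMF]

lemma poissonPMF_cons_update {m : ℕ} (b c : ℝ) (f : Fin m → ℝ) (i : Fin m)
    (z : Fin (m + 1) → ℕ) :
    poissonPMF (m + 1) 1 (Fin.cons b (Function.update f i c)) z =
      Real.exp (-(b + c + ∑ j ∈ Finset.univ.erase i, f j)) *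
        ((c ^ z i.succ * b ^ z 0) *
          ((∏ j ∈ Finset.univ.erase i, f j ^ z j.succ) /
            ∏ j, (Nat.factorial (z j) : ℝ))) := by
  have hs : ∑ j, Function.update f i c j = c + ∑ j ∈ Finset.univ.erase i, f j := by
    rw [← Finset.add_sum_erase _ _ (Finset.mem_univ i), Function.update_self]
    congr 1
    exact Finset.sum_congr rfl fun j hj => Function.update_of_ne (Finset.ne_of_mem_erase hj) _ _
  have hp : ∏ j, Function.update f i c j ^ z j.succ =
      c ^ z i.succ * ∏ j ∈ Finset.univ.erase i, f j ^ z j.succ := by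
    rw [← Finset.mul_prod_erase _ _ (Finset.mem_univ i), Function.update_self]
    congr 1
    exact Finset.prod_congr rfl fun j hj => by
      rw [Function.update_of_ne (Finset.ne_of_mem_erase hj)]
  rw [poissonPMF_one_eq, Fin.sum_univ_succ, Fin.prod_univ_succ (fun j => _ ^ z j)]
  simp only [Fin.cons_zero, Fin.cons_succ, hs, hp, ← add_assoc]
  ring

/-- Intensity vector of total mass `N` whose coordinates after the first are prescribed by `f`. -/
def fillIntensity {m : ℕ} (N : ℝ) (f : Fin m → ℝ) : Fin (m + 1) → ℝ :=
  Fin.cons (N - ∑ j, f j) f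

lemma fillIntensity_nonneg {m : ℕ} {N M : ℝ} {f : Fin m → ℝ} (hf : ∀ j, 0 ≤ f j ∧ f j ≤ M)
    (hN : m * M ≤ N) (i : Fin (m + 1)) : 0 ≤ fillIntensity N f i := by
  refine Fin.cases ?_ (fun j => (hf j).1) i
  have : ∑ j, f j ≤ ∑ _j : Fin m, M := Finset.sum_le_sum fun j _ => (hf j).2
  simp at this
  simp only [fillIntensity, Fin.cons_zero]
  linarith

section

variable {ι : Type*} [Fintype ι]

/-- Resampling one coordinate from two moment-matched priors barely changes the Poisson law. -/
lemma abs_sum_poissonPMF_fillIntensity_le {m L : ℕ} {W lam : ι → ℝ} {M N K : ℝ}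
    (hW : ∀ d ≤ L, ∑ a, W a * lam a ^ d = 0) (hW1 : ∑ a, |W a| ≤ 2)
    (hlam : ∀ a, 0 ≤ lam a ∧ lam a ≤ M) (hM : 0 ≤ M) (hN : m * M ≤ N) (hK : 1 ≤ K)
    (i : Fin m) (k : Fin m → ι) :
    ∃ μ : Fin (m + 1) → ℝ, (∀ j, 0 ≤ 1 * μ j) ∧ ∀ z,
      |∑ a, W a * poissonPMF (m + 1) 1 (fillIntensity N (lam ∘ Function.update k i a)) z| ≤
        2 / K ^ L * Real.exp ((2 * K - 1) * M) * poissonPMF (m + 1) 1 μ z := by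
  set T := ∑ j ∈ Finset.univ.erase i, (lam ∘ k) j with hT
  set A := N - T with hA
  have hTM : T ≤ (m - 1) * M := by
    have : T ≤ ∑ j ∈ Finset.univ.erase i, M := Finset.sum_le_sum fun j _ => (hlam (k j)).2
    rw [Finset.sum_const, Finset.card_erase_of_mem (Finset.mem_univ i), nsmul_eq_mul,
      Finset.card_univ, Fintype.card_fin, Nat.cast_sub (by have := i.pos; omega)] at this
    simpa using this
  have hMA : M ≤ A := by rw [hA]; linarith
  have hKM : M ≤ K * M := le_mul_of_one_le_left hM hK
  refine ⟨Fin.cons (A - M + K * M) (Function.update (lam ∘ k) i (K * M)), ?_, fun z => ?_⟩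
  · intro j
    rw [one_mul]
    refine Fin.cases ?_ (fun j => ?_) j
    · simp only [Fin.cons_zero]; linarith
    · simp only [Fin.cons_succ]
      by_cases h : j = i
      · subst h; rw [Function.update_self]; positivity
      · rw [Function.update_of_ne h]; exact (hlam _).1
  · have hfill : ∀ a, fillIntensity N (lam ∘ Function.update k i a) =
        Fin.cons (A - lam a) (Function.update (lam ∘ k) i (lam a)) := by
      intro a
      rw [Function.comp_update, fillIntensity]
      congr 1
      rw [← Finset.add_sum_erase _ _ (Finset.mem_univ i), Function.update_self, hA, hT]
      rw [Finset.sum_congr rfl fun j hj =>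
        Function.update_of_ne (Finset.ne_of_mem_erase hj) (lam a) (lam ∘ k)]
      ring
    simp_rw [hfill, poissonPMF_cons_update, ← hT]
    set R := (∏ j ∈ Finset.univ.erase i, (lam ∘ k) j ^ z j.succ) /
      ∏ j, (Nat.factorial (z j) : ℝ) with hR
    have hR0 : 0 ≤ R := by
      have : 0 ≤ ∏ j ∈ Finset.univ.erase i, (lam ∘ k) j ^ z j.succ :=
        Finset.prod_nonneg fun j _ => pow_nonneg (hlam _).1 _
      positivity
    have he : ∀ a, W a * (Real.exp (-(A - lam a + lam a + T)) *
        (lam a ^ z i.succ * (A - lam a) ^ z 0 * R)) =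
        Real.exp (-N) * R * (W a * (lam a ^ z i.succ * (A - lam a) ^ z 0)) := by
      intro a
      rw [show A - lam a + lam a + T = N by rw [hA]; ring]
      ring
    simp_rw [he]
    rw [← Finset.mul_sum, abs_mul, abs_of_nonneg (by positivity)]
    calc _ ≤ Real.exp (-N) * R *
          (2 / K ^ L * ((K * M) ^ z i.succ * (A - M + K * M) ^ z 0)) :=
          mul_le_mul_of_nonneg_left
            (abs_sum_mul_pow_mul_sub_pow_le hW hW1 hlam hM hMA hK _ _) (by positivity)
      _ = _ := by
          have : Real.exp (-N) = Real.exp ((2 * K - 1) * M) *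
              Real.exp (-(A - M + K * M + K * M + T)) := by
            rw [← Real.exp_add]; congr 1; rw [hA]; ring
          rw [this]; ring

lemma abs_sum_tsum_poissonPMF_fillIntensity_le {m L : ℕ} {W lam : ι → ℝ} {M N K : ℝ}
    (hW : ∀ d ≤ L, ∑ a, W a * lam a ^ d = 0) (hW1 : ∑ a, |W a| ≤ 2)
    (hlam : ∀ a, 0 ≤ lam a ∧ lam a ≤ M) (hM : 0 ≤ M) (hN : m * M ≤ N) (hK : 1 ≤ K)
    (h : (Fin (m + 1) → ℕ) → ℝ) (hh : ∀ z, |h z| ≤ 1) (i : Fin m) (k : Fin m → ι) :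
    |∑ a, W a * ∑' z, poissonPMF (m + 1) 1
        (fillIntensity N (lam ∘ Function.update k i a)) z * h z| ≤
      2 / K ^ L * Real.exp ((2 * K - 1) * M) := by
  obtain ⟨μ, hμ, hb⟩ := abs_sum_poissonPMF_fillIntensity_le hW hW1 hlam hM hN hK i k
  have hs : ∀ a, Summable fun z => poissonPMF (m + 1) 1
      (fillIntensity N (lam ∘ Function.update k i a)) z * h z := by
    intro a
    have hp : ∀ j, 0 ≤ 1 * fillIntensity N (lam ∘ Function.update k i a) j := fun j => by
      rw [one_mul]; exact fillIntensity_nonneg (fun _ => hlam _) hN j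
    refine Summable.of_norm_bounded (hasSum_poissonPMF hp).summable fun z => ?_
    rw [Real.norm_eq_abs, abs_mul, abs_of_nonneg (poissonPMF_nonneg hp z)]
    exact mul_le_of_le_one_right (poissonPMF_nonneg hp z) (hh z)
  have hμs := (hasSum_poissonPMF hμ).mul_left (2 / K ^ L * Real.exp ((2 * K - 1) * M))
  simp_rw [← tsum_mul_left]
  rw [← Summable.tsum_finsetSum fun a _ => (hs a).mul_left _, ← Real.norm_eq_abs]
  rw [mul_one] at hμs
  refine tsum_of_norm_bounded hμs fun z => ?_
  simp_rw [← mul_assoc]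
  rw [← Finset.sum_mul, Real.norm_eq_abs, abs_mul]
  exact (mul_le_of_le_one_right (abs_nonneg _) (hh z)).trans (hb z)

end

/-- Markov's inequality for the squared error of an estimator. -/
lemma tsum_poissonPMF_indicator_le {S : ℕ} {lam : ℝ} {P : Fin S → ℝ} (hP : ∀ i, 0 ≤ lam * P i)
    {t r Δ : ℝ} {est : (Fin S → ℕ) → ℝ} (hr : 0 ≤ r) (hΔ : 0 < Δ)
    (hrisk : poissonRisk S lam P t est ≤ ENNReal.ofReal (r * Δ ^ 2))
    {h : (Fin S → ℕ) → ℝ} (h0 : ∀ z, 0 ≤ h z) (hh : ∀ z, h z * Δ ^ 2 ≤ (est z - t) ^ 2)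
    (hs : Summable fun z => poissonPMF S lam P z * h z) :
    ∑' z, poissonPMF S lam P z * h z ≤ r := by
  have hΔ2 : 0 < Δ ^ 2 := by positivity
  have h1 : ENNReal.ofReal (∑' z, poissonPMF S lam P z * h z * Δ ^ 2) ≤
      ENNReal.ofReal (r * Δ ^ 2) := by
    rw [ENNReal.ofReal_tsum_of_nonneg
      (fun z => mul_nonneg (mul_nonneg (poissonPMF_nonneg hP z) (h0 z)) hΔ2.le) (hs.mul_right _)]
    refine le_trans (ENNReal.tsum_le_tsum fun z => ENNReal.ofReal_le_ofReal ?_) hrisk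
    rw [mul_assoc]
    exact mul_le_mul_of_nonneg_left (hh z) (poissonPMF_nonneg hP z)
  rw [ENNReal.ofReal_le_ofReal_iff (by positivity), tsum_mul_right] at h1
  exact le_of_mul_le_mul_right h1 hΔ2

section

variable {ι : Type*} [Fintype ι]

/-- The method of two fuzzy hypotheses for moment-matched product priors. -/
lemma le_poissonMinimax_of_priors {m L : ℕ} (F : (Fin (m + 1) → ℝ) → ℝ) {u v lam : ι → ℝ}
    {M N K mid Δ : ℝ} (hu : ∀ a, 0 ≤ u a) (hv : ∀ a, 0 ≤ v a) (hu1 : ∑ a, u a = 1)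
    (hv1 : ∑ a, v a = 1) (hW : ∀ d ≤ L, ∑ a, (u a - v a) * lam a ^ d = 0)
    (hlam : ∀ a, 0 ≤ lam a ∧ lam a ≤ M) (hM : 0 ≤ M) (hN : m * M ≤ N) (hN0 : 0 < N)
    (hK : 1 ≤ K) (hΔ : 0 < Δ)
    (hgu : productMean u (fun k : Fin m → ι =>
      if mid + Δ ≤ F (fun i => fillIntensity N (lam ∘ k) i / N) then (0 : ℝ) else 1) ≤ 1 / 8)
    (hgv : productMean v (fun k : Fin m → ι =>
      if F (fun i => fillIntensity N (lam ∘ k) i / N) ≤ mid - Δ then (0 : ℝ) else 1) ≤ 1 / 8)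
    (hδ : m * (2 / K ^ L * Real.exp ((2 * K - 1) * M)) < 1 / 4) :
    ENNReal.ofReal (1 / 4 * Δ ^ 2) ≤ poissonMinimax (m + 1) N F := by
  by_contra! hlt
  obtain ⟨est, hest⟩ := iInf_lt_iff.1 hlt
  set P : (Fin m → ι) → Fin (m + 1) → ℝ := fun k i => fillIntensity N (lam ∘ k) i / N with hPdef
  have hq0 : ∀ k i, 0 ≤ fillIntensity N (lam ∘ k) i := fun k i =>
    fillIntensity_nonneg (fun _ => hlam _) hN i
  have hNP : ∀ k i, N * P k i = fillIntensity N (lam ∘ k) i := fun k i =>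
    mul_div_cancel₀ _ hN0.ne'
  have hP0 : ∀ k i, 0 ≤ N * P k i := fun k i => by rw [hNP]; exact hq0 k i
  have hPs : ∀ k, P k ∈ simplex (m + 1) := fun k => by
    refine ⟨fun i => div_nonneg (hq0 k i) hN0.le, ?_⟩
    simp only [hPdef, ← Finset.sum_div, Fin.sum_univ_succ, fillIntensity, Fin.cons_zero,
      Fin.cons_succ, sub_add_cancel]
    exact div_self hN0.ne'
  have hrisk : ∀ k, poissonRisk (m + 1) N (P k) (F (P k)) est ≤
      ENNReal.ofReal (1 / 4 * Δ ^ 2) := fun k =>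
    (le_iSup₂ (f := fun P (_ : P ∈ simplex (m + 1)) => poissonRisk (m + 1) N P (F P) est)
      (P k) (hPs k)).trans hest.le
  set h : (Fin (m + 1) → ℕ) → ℝ := fun z => if mid ≤ est z then 1 else 0 with hh
  have hh0 : ∀ z, 0 ≤ h z := fun z => by simp only [hh]; split_ifs <;> norm_num
  have hh1 : ∀ z, h z ≤ 1 := fun z => by simp only [hh]; split_ifs <;> norm_num
  have hpmf : ∀ k, HasSum (poissonPMF (m + 1) N (P k)) 1 := fun k => hasSum_poissonPMF (hP0 k)
  have hsum : ∀ k, Summable fun z => poissonPMF (m + 1) N (P k) z * h z := fun k =>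
    Summable.of_nonneg_of_le (fun z => mul_nonneg (poissonPMF_nonneg (hP0 k) z) (hh0 z))
      (fun z => mul_le_of_le_one_right (poissonPMF_nonneg (hP0 k) z) (hh1 z)) (hpmf k).summable
  set Ψ : (Fin m → ι) → ℝ := fun k => ∑' z, poissonPMF (m + 1) N (P k) z * h z with hΨ
  have hΨ0 : ∀ k, 0 ≤ Ψ k := fun k =>
    tsum_nonneg fun z => mul_nonneg (poissonPMF_nonneg (hP0 k) z) (hh0 z)
  have hcomp : ∀ k, HasSum (fun z => poissonPMF (m + 1) N (P k) z * (1 - h z)) (1 - Ψ k) :=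
    fun k => by
      simp only [mul_sub, mul_one]
      exact (hpmf k).sub (hsum k).hasSum
  have hΨ1 : ∀ k, Ψ k ≤ 1 := fun k => by
    have := (hcomp k).nonneg fun z =>
      mul_nonneg (poissonPMF_nonneg (hP0 k) z) (sub_nonneg.2 (hh1 z))
    linarith
  have hup : ∀ k, 3 / 4 ≤ Ψ k + if mid + Δ ≤ F (P k) then (0 : ℝ) else 1 := fun k => by
    split_ifs with hg
    · have := tsum_poissonPMF_indicator_le (hP0 k) (by norm_num) hΔ (hrisk k)
        (h := fun z => 1 - h z) (fun z => sub_nonneg.2 (hh1 z)) (fun z => by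
          simp only [hh]
          split_ifs with hz
          · simp only [sub_self, zero_mul]; positivity
          · push Not at hz; nlinarith) (hcomp k).summable
      rw [(hcomp k).tsum_eq] at this
      linarith
    · linarith [hΨ0 k]
  have hlow : ∀ k, Ψ k ≤ 1 / 4 + if F (P k) ≤ mid - Δ then (0 : ℝ) else 1 := fun k => by
    split_ifs with hg
    · have := tsum_poissonPMF_indicator_le (hP0 k) (by norm_num) hΔ (hrisk k) hh0 (fun z => by
          simp only [hh]
          split_ifs with hz
          · nlinarith
          · simp only [zero_mul]; positivity) (hsum k)
      linarith
    · linarith [hΨ1 k]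
  have hΨeq : ∀ k, Ψ k = ∑' z, poissonPMF (m + 1) 1 (fillIntensity N (lam ∘ k)) z * h z :=
    fun k => tsum_congr fun z => by
      rw [poissonPMF_scale]; simp_rw [hNP]
  have hW1 : ∑ a, |u a - v a| ≤ 2 := by
    calc _ ≤ ∑ a, (u a + v a) := Finset.sum_le_sum fun a _ => by
          rw [abs_le]; constructor <;> linarith [hu a, hv a]
      _ = 2 := by rw [Finset.sum_add_distrib, hu1, hv1]; norm_num
  have htv := abs_productMean_sub_le hu hv hu1 hv1 Ψ
    (δ := 2 / K ^ L * Real.exp ((2 * K - 1) * M)) (fun i k => by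
      simp_rw [hΨeq]
      exact abs_sum_tsum_poissonPMF_fillIntensity_le hW hW1 hlam hM hN hK h
        (fun z => by rw [abs_of_nonneg (hh0 z)]; exact hh1 z) i k)
  have hu2 := productMean_mono hu hup
  rw [productMean_const hu1, productMean_add] at hu2
  have hv2 := productMean_mono hv hlow
  rw [productMean_add, productMean_const hv1] at hv2
  have := le_abs_self (productMean u Ψ - productMean v Ψ)
  linarith

end

section

variable {ι : Type*}

/-- `Falpha` on a filled vector is `1` plus the power sum of the prescribed coordinates, up to
the mass removed from the first coordinate. -/
lemma Falpha_fillIntensity_mem {m : ℕ} {α M N : ℝ} (h0 : 0 < α) (h1 : α ≤ 1 / 2) {x : ι → ℝ}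
    (hx : ∀ a, 0 ≤ x a ∧ x a ≤ 1) (hM : 0 < M) (hN : m * M ≤ N) (hN0 : 0 < N) (k : Fin m → ι) :
    1 - m * (M / N) + (M / N) ^ α * ∑ j, x (k j) ^ α ≤
        Falpha (m + 1) α (fun i => fillIntensity N ((fun a => M * x a) ∘ k) i / N) ∧
      Falpha (m + 1) α (fun i => fillIntensity N ((fun a => M * x a) ∘ k) i / N) ≤
        1 + (M / N) ^ α * ∑ j, x (k j) ^ α := by
  have hsum : ∑ j, x (k j) ≤ m := by
    calc _ ≤ ∑ _j : Fin m, (1 : ℝ) := Finset.sum_le_sum fun j _ => (hx _).2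
      _ = m := by simp
  have hsum0 : 0 ≤ ∑ j, x (k j) := Finset.sum_nonneg fun j _ => (hx _).1
  have hMN : 0 < M / N := by positivity
  have hmMN : m * (M / N) ≤ 1 := by rw [← mul_div_assoc, div_le_one hN0]; exact hN
  set p := 1 - M / N * ∑ j, x (k j) with hp
  have hF : Falpha (m + 1) α (fun i => fillIntensity N ((fun a => M * x a) ∘ k) i / N) =
      p ^ α + (M / N) ^ α * ∑ j, x (k j) ^ α := by
    simp only [Falpha, Fin.sum_univ_succ, fillIntensity, Fin.cons_zero, Fin.cons_succ,
      Function.comp, ← Finset.mul_sum]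
    congr 1
    · congr 1; rw [hp]; field_simp
    · rw [Finset.mul_sum]
      refine Finset.sum_congr rfl fun j _ => ?_
      rw [← Real.mul_rpow hMN.le (hx _).1]
      congr 1; ring
  have hp1 : p ≤ 1 := by rw [hp]; linarith [mul_nonneg hMN.le hsum0]
  have hpm : 1 - m * (M / N) ≤ p := by
    rw [hp]; linarith [mul_le_mul_of_nonneg_left hsum hMN.le]
  have hp0 : 0 ≤ p := by linarith
  rw [hF]
  constructor
  · have := Real.self_le_rpow_of_le_one hp0 hp1 (by linarith : α ≤ 1)
    linarith
  · have := Real.rpow_le_one hp0 hp1 h0.le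
    linarith

lemma le_poissonMinimax_Falpha_of_moments [Fintype ι] {m L : ℕ} {α M N K d : ℝ} (h0 : 0 < α)
    (h1 : α ≤ 1 / 2) {x u v : ι → ℝ} (hx : ∀ a, 0 ≤ x a ∧ x a ≤ 1) (hu : ∀ a, 0 ≤ u a)
    (hv : ∀ a, 0 ≤ v a) (hu1 : ∑ a, u a = 1) (hv1 : ∑ a, v a = 1)
    (hW : ∀ i ≤ L, ∑ a, (u a - v a) * x a ^ i = 0) (hd : ∑ a, (u a - v a) * x a ^ α = d)
    (hd0 : 0 < d) (hM : 0 < M) (hN : m * M ≤ N) (hN0 : 0 < N) (hK : 1 ≤ K)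
    (hMN : (M / N) ^ (1 - α) ≤ d / 8) (hmd : 512 ≤ m * d ^ 2)
    (hδ : m * (2 / K ^ L * Real.exp ((2 * K - 1) * M)) < 1 / 4) :
    ENNReal.ofReal (1 / 4 * ((M / N) ^ α * m * d / 4) ^ 2) ≤
      poissonMinimax (m + 1) N (Falpha (m + 1) α) := by
  have hm : (0 : ℝ) < m := by
    by_contra! hm
    nlinarith [sq_nonneg d]
  have hMN0 : 0 < M / N := by positivity
  set ρ := (M / N) ^ α with hρ
  have hρ0 : 0 < ρ := by positivity
  have hmass : m * (M / N) ≤ ρ * m * d / 8 := by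
    have : M / N = ρ * (M / N) ^ (1 - α) := by
      rw [hρ, ← Real.rpow_add hMN0]; simp
    calc m * (M / N) = m * (ρ * (M / N) ^ (1 - α)) := by rw [← this]
      _ ≤ m * (ρ * (d / 8)) := by gcongr
      _ = _ := by ring
  set Eu := ∑ a, u a * x a ^ α with hEu
  set Ev := ∑ a, v a * x a ^ α with hEv
  have hEd : Eu - Ev = d := by
    rw [← hd, hEu, hEv, ← Finset.sum_sub_distrib]
    exact Finset.sum_congr rfl fun a _ => by ring
  have ht : 0 < m * d / 8 := by positivity
  have htail : m / (m * d / 8) ^ 2 ≤ 1 / 8 := by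
    rw [div_le_iff₀ (by positivity)]
    nlinarith
  have hxα : ∀ a, 0 ≤ x a ^ α ∧ x a ^ α ≤ 1 := fun a =>
    ⟨Real.rpow_nonneg (hx a).1 _, Real.rpow_le_one (hx a).1 (hx a).2 h0.le⟩
  have hF := Falpha_fillIntensity_mem h0 h1 hx hM hN hN0
  refine le_poissonMinimax_of_priors (L := L) (K := K) (M := M) (u := u) (v := v)
    (lam := fun a => M * x a) (mid := 1 + ρ * m * (Eu + Ev) / 2) _
    hu hv hu1 hv1 ?_ ?_ hM.le hN hN0 hK (by positivity) ?_ ?_ hδ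
  · intro i hi
    have := hW i hi
    simp_rw [mul_pow, mul_left_comm _ (M ^ i)]
    rw [← Finset.mul_sum, this, mul_zero]
  · exact fun a => ⟨mul_nonneg hM.le (hx a).1, mul_le_of_le_one_right hM.le (hx a).2⟩
  · refine le_trans (productMean_mono hu fun k => ?_)
      ((productMean_deviation_le hu hu1 hxα ht m).trans htail)
    split_ifs with hg hb hb
    · norm_num
    · norm_num
    · norm_num
    · exfalso
      apply hg
      push Not at hb
      have hb' := mul_lt_mul_of_pos_left (abs_lt.1 hb).1 hρ0
      rw [← hEu] at hb'
      have := (hF k).1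
      have hEv' : Ev = Eu - d := by linarith
      rw [hEv']
      linarith
  · refine le_trans (productMean_mono hv fun k => ?_)
      ((productMean_deviation_le hv hv1 hxα ht m).trans htail)
    split_ifs with hg hb hb
    · norm_num
    · norm_num
    · norm_num
    · exfalso
      apply hg
      push Not at hb
      have hb' := mul_lt_mul_of_pos_left (abs_lt.1 hb).2 hρ0
      rw [← hEv] at hb'
      have := (hF k).2
      have hEu' : Eu = Ev + d := by linarith
      rw [hEu']
      linarith [mul_pos hρ0 ht]

end

lemma exists_log_sq_le {η : ℝ} (hη : 0 < η) :
    ∃ S₀ : ℕ, 3 ≤ S₀ ∧ ∀ S : ℕ, S₀ ≤ S → Real.log S ^ 2 ≤ η * S := by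
  have h := ((Real.isLittleO_pow_log_id_atTop (n := 2)).comp_tendsto
    (tendsto_natCast_atTop_atTop (R := ℝ))).bound hη
  obtain ⟨S₀, hS₀⟩ := Filter.eventually_atTop.1 h
  refine ⟨max S₀ 3, le_max_right _ _, fun S hS => ?_⟩
  have := hS₀ S ((le_max_left _ _).trans hS)
  simpa using this

lemma mul_exp_tail_lt {m S L : ℕ} (hS : 3 ≤ S) (hm : m ≤ S) (hL : 6 * Real.log S ≤ L) :
    m * (2 / Real.exp 1 ^ L * Real.exp ((2 * Real.exp 1 - 1) * (L / 10))) < 1 / 4 := by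
  have hS0 : (3 : ℝ) ≤ S := by exact_mod_cast hS
  have hm' : (m : ℝ) ≤ S := by exact_mod_cast hm
  have he := Real.exp_one_lt_d9
  have hexp : 2 / Real.exp 1 ^ L * Real.exp ((2 * Real.exp 1 - 1) * (L / 10)) ≤
      2 * (1 / (S : ℝ) ^ 3) := by
    rw [← Real.exp_nat_mul, mul_one, div_mul_eq_mul_div, mul_div_assoc, ← Real.exp_sub]
    have : 1 / (S : ℝ) ^ 3 = Real.exp (-(3 * Real.log S)) := by
      rw [Real.exp_neg, mul_comm, Real.exp_mul, Real.exp_log (by linarith), one_div]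
      norm_cast
    rw [this]
    gcongr
    nlinarith [(Nat.cast_nonneg L : (0 : ℝ) ≤ L)]
  calc _ ≤ (S : ℝ) * (2 * (1 / (S : ℝ) ^ 3)) := by gcongr
    _ = 2 / (S : ℝ) ^ 2 := by field_simp
    _ < 1 / 4 := by
      rw [div_lt_div_iff₀ (by positivity) (by norm_num)]
      nlinarith

lemma one_lt_log_of_three_le {S : ℕ} (hS : 3 ≤ S) : 1 < Real.log S := by
  rw [Real.lt_log_iff_exp_lt (by positivity)]
  have : (3 : ℝ) ≤ S := by exact_mod_cast hS
  linarith [Real.exp_one_lt_d9]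

lemma div_rpow_one_sub_le {α c c₀ s l n M d : ℝ} (h1 : α ≤ 1 / 2) (hc₀ : 0 < c₀)
    (hs : 0 < s) (hl : 0 < l) (hn0 : 0 < n) (hM0 : 0 < M) (hMl : M ≤ l)
    (hnl : c₀ * s ^ 2 ≤ n * l) (hl_b : l ^ 2 ≤ c * √c₀ / 64 * s) (hMn : M ≤ n)
    (hd1 : c / (8 * l) ≤ d) : (M / n) ^ (1 - α) ≤ d / 8 := by
  have hq : M / n ≤ (l / (√c₀ * s)) ^ 2 := by
    rw [div_pow, mul_pow, Real.sq_sqrt hc₀.le, div_le_div_iff₀ hn0 (by positivity)]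
    calc M * (c₀ * s ^ 2) ≤ l * (n * l) := by gcongr
      _ = l ^ 2 * n := by ring
  have hq1 : M / n ≤ 1 := (div_le_one hn0).2 hMn
  calc (M / n) ^ (1 - α) ≤ (M / n) ^ (1 / 2 : ℝ) :=
        Real.rpow_le_rpow_of_exponent_ge (by positivity) hq1 (by linarith)
    _ = √(M / n) := (Real.sqrt_eq_rpow _).symm
    _ ≤ l / (√c₀ * s) := by
        rw [Real.sqrt_le_left (by positivity)]
        exact hq
    _ ≤ c / (8 * l) / 8 := by
        rw [div_div, div_le_div_iff₀ (by positivity) (by positivity)]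
        nlinarith
    _ ≤ d / 8 := by gcongr

lemma mul_div_rpow_le {α c s l n m M d k : ℝ} (h0 : 0 < α) (h1 : α ≤ 1 / 2) (hc : 0 < c)
    (hs : 0 < s) (hl : 0 < l) (hn0 : 0 < n) (hln : l ≤ k) (hlM : l / 2 ≤ M)
    (hsm : s / 2 ≤ m) (hd8 : c * (8 * l) ^ (-(2 * α)) ≤ d) :
    c / 128 * (s / (n * k) ^ α) ≤ (M / n) ^ α * m * d / 4 := by
  have hM0 : 0 < M := by linarith
  have hm0 : 0 < m := by linarith
  have h2 : (1 / 16 : ℝ) * l ^ (-α) ≤ (l / 2) ^ α * (8 * l) ^ (-(2 * α)) := by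
    rw [Real.div_rpow (by positivity) (by norm_num), Real.mul_rpow (by norm_num) (by positivity)]
    have e1 : l ^ α * l ^ (-(2 * α)) = l ^ (-α) := by
      rw [← Real.rpow_add (by positivity)]; ring_nf
    have e2 : (2 : ℝ) ^ α ≤ 2 := by
      calc (2 : ℝ) ^ α ≤ 2 ^ (1 : ℝ) :=
            Real.rpow_le_rpow_of_exponent_le (by norm_num) (by linarith)
        _ = 2 := by norm_num
    have e3 : (1 / 8 : ℝ) ≤ 8 ^ (-(2 * α)) := by
      calc (1 / 8 : ℝ) = 8 ^ (-1 : ℝ) := by rw [Real.rpow_neg_one]; norm_num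
        _ ≤ _ := Real.rpow_le_rpow_of_exponent_le (by norm_num) (by linarith)
    calc (1 / 16 : ℝ) * l ^ (-α) = 1 / 2 * (1 / 8) * l ^ (-α) := by ring
      _ ≤ 1 / 2 ^ α * 8 ^ (-(2 * α)) * l ^ (-α) := by gcongr
      _ = _ := by rw [← e1]; ring
  calc c / 128 * (s / (n * k) ^ α) ≤ c / 128 * (s / (n * l) ^ α) := by
        gcongr
    _ = c / 8 * (s * (1 / 16 * l ^ (-α)) / n ^ α) := by
        rw [Real.mul_rpow hn0.le (by positivity), Real.rpow_neg (by positivity)]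
        field_simp
        norm_num
    _ ≤ c / 8 * (s * ((l / 2) ^ α * (8 * l) ^ (-(2 * α))) / n ^ α) := by gcongr
    _ = (l / 2) ^ α / n ^ α * (s / 2) * (c * (8 * l) ^ (-(2 * α))) / 4 := by ring
    _ ≤ (M / n) ^ α * m * d / 4 := by
        rw [← Real.div_rpow (by positivity) hn0.le]
        gcongr

set_option maxHeartbeats 800000 in
/-- Lower bound for large alphabets. -/
theorem le_poissonMinimax_Falpha_of_large {α c₀ : ℝ} (h0 : 0 < α) (h1 : α ≤ 1 / 2)
    (hc₀ : 0 < c₀) :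
    ∃ C : ℝ, 0 < C ∧ ∃ S₀ : ℕ, ∀ S n : ℕ, S₀ ≤ S → 2 ≤ n →
      c₀ * (S : ℝ) ^ (1 / α) ≤ n * Real.log S →
      ENNReal.ofReal (C * ((S : ℝ) ^ 2 / ((n : ℝ) * Real.log n) ^ (2 * α))) ≤
        poissonMinimax S (n : ℝ) (Falpha S α) := by
  obtain ⟨c, hc, hmom⟩ := exists_moment_matching h0 h1
  set η := min c₀ (min (c * √c₀ / 64) (c ^ 2 / 65536)) with hη
  have hη0 : 0 < η := by rw [hη]; positivity
  obtain ⟨S₀, hS₀, hlog⟩ := exists_log_sq_le hη0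
  refine ⟨1 / 4 * (c / 128) ^ 2, by positivity, S₀, fun S n hS hn hSn => ?_⟩
  obtain ⟨m, rfl⟩ : ∃ m, S = m + 1 := ⟨S - 1, by omega⟩
  have hS3 : 3 ≤ m + 1 := hS₀.trans hS
  have hl := hlog _ hS
  have hl1 := one_lt_log_of_three_le hS3
  set s : ℝ := ((m + 1 : ℕ) : ℝ) with hs
  set l := Real.log s with hldef
  have hs3 : (3 : ℝ) ≤ s := by rw [hs]; exact_mod_cast hS3
  have hms : (m : ℝ) = s - 1 := by rw [hs]; push_cast; ring
  have hn0 : (0 : ℝ) < n := by positivity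
  have hl_a : l ^ 2 ≤ c₀ * s := hl.trans (by gcongr; exact min_le_left _ _)
  have hl_b : l ^ 2 ≤ c * √c₀ / 64 * s :=
    hl.trans (by gcongr; exact (min_le_right _ _).trans (min_le_left _ _))
  have hl_c : l ^ 2 ≤ c ^ 2 / 65536 * s :=
    hl.trans (by gcongr; exact (min_le_right _ _).trans (min_le_right _ _))
  have hnl : c₀ * s ^ 2 ≤ n * l := by
    refine le_trans ?_ hSn
    gcongr
    rw [← Real.rpow_natCast]
    refine Real.rpow_le_rpow_of_exponent_le (by linarith) ?_
    rw [le_div_iff₀ h0]; push_cast; linarith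
  have hsn : s * l ≤ n := by
    have : s * l * l ≤ n * l := by nlinarith
    exact le_of_mul_le_mul_right this (by linarith)
  set L := ⌈6 * l⌉₊ with hL
  have hL6 : 6 * l ≤ L := Nat.le_ceil _
  have hL7 : (L : ℝ) ≤ 7 * l := by
    have := Nat.ceil_lt_add_one (by linarith : 0 ≤ 6 * l)
    rw [← hL] at this
    linarith
  have hL0 : (0 : ℝ) < L := by linarith
  obtain ⟨x, u, v, hx, hu, hv, hu1, hv1, hW, hd⟩ := hmom L (by exact_mod_cast hL0)
  set d := ∑ k, (u k - v k) * x k ^ α with hddef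
  have hd8 : c * (8 * l) ^ (-(2 * α)) ≤ d := by
    refine le_trans ?_ hd
    gcongr ?_ * ?_
    exact Real.rpow_le_rpow_of_nonpos hL0 (by linarith) (by linarith)
  have hd1 : c / (8 * l) ≤ d := by
    refine le_trans ?_ hd8
    rw [div_eq_mul_inv, ← Real.rpow_neg_one]
    gcongr
    · linarith
    · linarith
  have hd0 : 0 < d := lt_of_lt_of_le (by positivity) hd1
  set M : ℝ := L / 10 with hM
  have hM0 : 0 < M := by positivity
  have hMl : M ≤ l := by rw [hM]; linarith
  have hlM : l / 2 ≤ M := by rw [hM]; linarith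
  have hMn : (m : ℝ) * M ≤ n := by
    rw [hms]
    nlinarith
  have hMn1 : M ≤ n := by nlinarith
  have hMN : (M / n) ^ (1 - α) ≤ d / 8 :=
    div_rpow_one_sub_le h1 hc₀ (by linarith) (by linarith) hn0 hM0 hMl hnl hl_b hMn1 hd1
  have hmd : 512 ≤ m * d ^ 2 := by
    have hd2 : c ^ 2 / (64 * l ^ 2) ≤ d ^ 2 := by
      calc c ^ 2 / (64 * l ^ 2) = (c / (8 * l)) ^ 2 := by rw [div_pow]; ring
        _ ≤ d ^ 2 := by gcongr
    calc (512 : ℝ) ≤ (s / 2) * (c ^ 2 / (64 * l ^ 2)) := by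
          rw [div_mul_div_comm, le_div_iff₀ (by positivity)]
          nlinarith
      _ ≤ m * d ^ 2 := by
          gcongr
          rw [hms]; linarith
  refine le_trans (ENNReal.ofReal_le_ofReal ?_)
    (le_poissonMinimax_Falpha_of_moments (K := Real.exp 1) h0 h1 hx hu hv hu1 hv1 hW rfl hd0 hM0
      hMn hn0 (Real.one_le_exp (by norm_num)) hMN hmd
      (mul_exp_tail_lt hS3 (Nat.le_succ m) hL6))
  have hln : l ≤ Real.log n := Real.log_le_log (by linarith) (by nlinarith)
  have hpow : ((n : ℝ) * Real.log n) ^ (2 * α) = (((n : ℝ) * Real.log n) ^ α) ^ 2 := by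
    rw [mul_comm 2 α, Real.rpow_mul (by positivity)]
    norm_cast
  rw [hpow, mul_assoc, ← div_pow, ← mul_pow]
  gcongr
  exact mul_div_rpow_le h0 h1 hc (by linarith) (by linarith) hn0 hln hlM
    (by rw [hms]; linarith) hd8

lemma poissonPMF_zero_of_mem_simplex {S : ℕ} (lam : ℝ) {P : Fin S → ℝ} (hP : P ∈ simplex S) :
    poissonPMF S lam P 0 = Real.exp (-lam) := by
  simp only [poissonPMF, Pi.zero_apply, pow_zero, mul_one, Nat.factorial_zero, Nat.cast_one,
    div_one, ← Real.exp_sum, Finset.sum_neg_distrib, ← Finset.mul_sum, hP.2]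

/-- Two-point lower bound from the event that nothing is observed. -/
lemma le_poissonMinimax_of_two_points {S : ℕ} (lam : ℝ) (F : (Fin S → ℝ) → ℝ)
    {P Q : Fin S → ℝ} (hP : P ∈ simplex S) (hQ : Q ∈ simplex S) :
    ENNReal.ofReal (Real.exp (-lam) * ((F P - F Q) ^ 2 / 4)) ≤ poissonMinimax S lam F := by
  refine le_iInf fun est => ?_
  have key : ∀ R ∈ simplex S, ENNReal.ofReal (Real.exp (-lam) * (est 0 - F R) ^ 2) ≤
      ⨆ P ∈ simplex S, poissonRisk S lam P (F P) est := fun R hR => by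
    refine le_trans ?_ (le_iSup₂ (f := fun P (_ : P ∈ simplex S) =>
      poissonRisk S lam P (F P) est) R hR)
    rw [← poissonPMF_zero_of_mem_simplex lam hR]
    exact ENNReal.le_tsum (f := fun z => ENNReal.ofReal
      (poissonPMF S lam R z * (est z - F R) ^ 2)) 0
  rcases le_total ((est 0 - F P) ^ 2) ((est 0 - F Q) ^ 2) with h | h
  · refine le_trans (ENNReal.ofReal_le_ofReal ?_) (key Q hQ)
    gcongr
    nlinarith [sq_nonneg (est 0 - F P + (est 0 - F Q))]
  · refine le_trans (ENNReal.ofReal_le_ofReal ?_) (key P hP)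
    gcongr
    nlinarith [sq_nonneg (est 0 - F P + (est 0 - F Q))]

lemma le_poissonMinimax_Falpha_exp {S : ℕ} {α : ℝ} (h0 : 0 < α) (hS : 2 ≤ S) (lam : ℝ) :
    ENNReal.ofReal (Real.exp (-lam) * ((2 * (1 / 2 : ℝ) ^ α - 1) ^ 2 / 4)) ≤
      poissonMinimax S lam (Falpha S α) := by
  obtain ⟨k, rfl⟩ : ∃ k, S = k + 2 := ⟨S - 2, by omega⟩
  have hP : (Fin.cons (1 / 2) (Fin.cons (1 / 2) fun _ => 0) : Fin (k + 2) → ℝ) ∈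
      simplex (k + 2) := by
    refine ⟨fun i => ?_, ?_⟩
    · refine Fin.cases (by norm_num) (fun i => ?_) i
      refine Fin.cases (by norm_num) (fun i => by simp) i
    · simp [Fin.sum_univ_succ]; norm_num
  have hQ : (Fin.cons 1 fun _ => 0 : Fin (k + 2) → ℝ) ∈ simplex (k + 2) := by
    refine ⟨fun i => ?_, ?_⟩
    · refine Fin.cases (by norm_num) (fun i => by simp) i
    · simp [Fin.sum_univ_succ (n := k + 1)]
  have h := le_poissonMinimax_of_two_points lam (Falpha (k + 2) α) hP hQ
  have hFP : Falpha (k + 2) α (Fin.cons (1 / 2) (Fin.cons (1 / 2) fun _ => 0)) =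
      2 * (1 / 2 : ℝ) ^ α := by
    simp only [Falpha, Fin.sum_univ_succ, Fin.cons_zero, Fin.cons_succ, Real.zero_rpow h0.ne',
      Finset.sum_const_zero]
    ring
  have hFQ : Falpha (k + 2) α (Fin.cons 1 fun _ => 0) = 1 := by
    simp [Falpha, Fin.sum_univ_succ (n := k + 1), Real.zero_rpow h0.ne']
  rwa [hFP, hFQ] at h

/-- Lower bound for bounded alphabets. -/
theorem le_poissonMinimax_Falpha_of_small {α c₁ : ℝ} (h0 : 0 < α) (h1 : α ≤ 1 / 2)
    (hc₁ : 0 < c₁) (S₀ : ℕ) :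
    ∃ C : ℝ, 0 < C ∧ ∀ S n : ℕ, S ≤ S₀ → 2 ≤ S → 2 ≤ n → Real.log n ≤ c₁ * Real.log S →
      ENNReal.ofReal (C * ((S : ℝ) ^ 2 / ((n : ℝ) * Real.log n) ^ (2 * α))) ≤
        poissonMinimax S (n : ℝ) (Falpha S α) := by
  set g := 2 * (1 / 2 : ℝ) ^ α - 1 with hg
  have hg0 : 0 < g := by
    have := Real.rpow_lt_rpow_of_exponent_gt (by norm_num : (0 : ℝ) < 1 / 2) (by norm_num)
      (by linarith : α < 1)
    rw [Real.rpow_one] at this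
    linarith
  set B := Real.exp (c₁ * Real.log S₀) with hB
  refine ⟨Real.exp (-B) * (g ^ 2 / 4) / ((S₀ : ℝ) + 1) ^ 2, by positivity,
    fun S n hSS hS hn hlog => ?_⟩
  refine le_trans (ENNReal.ofReal_le_ofReal ?_) (le_poissonMinimax_Falpha_exp h0 hS _)
  have hn2 : (2 : ℝ) ≤ n := by exact_mod_cast hn
  have hS2 : (2 : ℝ) ≤ S := by exact_mod_cast hS
  have hSS' : (S : ℝ) ≤ S₀ := by exact_mod_cast hSS
  have hnB : (n : ℝ) ≤ B := by
    rw [hB, ← Real.log_le_iff_le_exp (by linarith)]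
    refine hlog.trans ?_
    gcongr
  have hnl : 1 ≤ (n : ℝ) * Real.log n := by
    have := Real.log_le_log (by norm_num) hn2
    nlinarith [Real.log_two_gt_d9]
  have hr : (S : ℝ) ^ 2 / ((n : ℝ) * Real.log n) ^ (2 * α) ≤ ((S₀ : ℝ) + 1) ^ 2 :=
    (div_le_self (by positivity) (Real.one_le_rpow hnl (by linarith))).trans
      (by gcongr; linarith)
  calc _ ≤ Real.exp (-B) * (g ^ 2 / 4) / ((S₀ : ℝ) + 1) ^ 2 * ((S₀ : ℝ) + 1) ^ 2 := by gcongr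
    _ = Real.exp (-B) * (g ^ 2 / 4) := by field_simp
    _ ≤ _ := by gcongr

end

theorem Falpha_minimax_rate_small_alpha (α : ℝ) (hα0 : 0 < α) (hα : α ≤ 1 / 2)
    (c₀ c₁ : ℝ) (hc₀ : 0 < c₀) (hc₁ : 0 < c₁) :
    ∃ C₁ C₂ : ℝ, 0 < C₁ ∧ 0 < C₂ ∧
      ∀ S n : ℕ, 2 ≤ S → 2 ≤ n →
        c₀ * (S : ℝ) ^ (1 / α) ≤ (n : ℝ) * Real.log S →
        Real.log n ≤ c₁ * Real.log S →
        ENNReal.ofReal (C₁ * ((S : ℝ) ^ 2 / ((n : ℝ) * Real.log n) ^ (2 * α)))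
            ≤ poissonMinimax S (n : ℝ) (Falpha S α) ∧
        poissonMinimax S (n : ℝ) (Falpha S α)
            ≤ ENNReal.ofReal (C₂ * ((S : ℝ) ^ 2 / ((n : ℝ) * Real.log n) ^ (2 * α))) := by
  obtain ⟨C₂, hC₂, hupper⟩ := poissonMinimax_Falpha_le hα0 hα hc₁
  obtain ⟨C, hC, S₀, hlarge⟩ := le_poissonMinimax_Falpha_of_large hα0 hα hc₀
  obtain ⟨C', hC', hsmall⟩ := le_poissonMinimax_Falpha_of_small hα0 hα hc₁ S₀
  refine ⟨min C C', C₂, lt_min hC hC', hC₂, fun S n hS hn hSn hlog =>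
    ⟨?_, hupper S n hS hn hlog⟩⟩
  rcases le_total S₀ S with h | h
  · refine le_trans (ENNReal.ofReal_le_ofReal ?_) (hlarge S n h hn hSn)
    gcongr
    exact min_le_left _ _
  · refine le_trans (ENNReal.ofReal_le_ofReal ?_) (hsmall S n h hS hn hlog)
    gcongr
    exact min_le_right _ _
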